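/- arXiv:2306.11951 — 5 statements merged into one kernel-verified Lean document; each statement's English description precedes it below -/
import Mathlib

section
/- For every K ≥ 1, p ∈ (0,1/2) and T ≥ 0, any adaptive T-round algorithm for computing the OR of K noisy bits satisfies sup over θ ∈ {0,1}^K of P(μ̂ ≠ OR(θ)) ≥ (1/4)·exp(−T·D_KL(p‖1−p)/K). Consequently, any such algorithm whose worst-case error probability is at most δ < 1/4 must use T ≥ K·ln(1/(4δ))/D_KL(p‖1−p) queries. -/
/-- KL divergence (in nats) between `Bernoulli(p)` and `Bernoulli(1-p)`:
`D_KL(p‖1-p) = (1-2p) ln((1-p)/p)`. -/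
noncomputable def klBer (p : ℝ) : ℝ := (1 - 2 * p) * Real.log ((1 - p) / p)

/-- The OR of `K` bits. -/
def orFun {K : ℕ} (θ : Fin K → Bool) : Bool := decide (∃ k, θ k = true)

/-- Error probability of a deterministic adaptive `T`-round strategy for computing the
OR of `K` noisy bits when the true bits are `θ` and each observation is flipped
independently with probability `p`.  The strategy is described by a query rule `q`,
where `q t ys` is the index queried at round `t` (depending only on the observations
`ys s` for `s < t`, which is enforced by a separate hypothesis), and an output rule
`out`.  The error probability is the total probability of the observation sequences
`ys : Fin T → Bool` on which the output disagrees with `OR(θ)`. -/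
noncomputable def detErrOR (K T : ℕ) (p : ℝ)
    (q : Fin T → (Fin T → Bool) → Fin K)
    (out : (Fin T → Bool) → Bool) (θ : Fin K → Bool) : ℝ :=
  ∑ ys : Fin T → Bool,
    (∏ t : Fin T, if ys t = θ (q t ys) then 1 - p else p) *
      (if out ys = orFun θ then 0 else 1)

/-- Bretagnolle–Huber inequality on a finite space, for `P` and `Q = P * exp (-L)` and a
randomized test `f`. -/
theorem bretagnolle_huber_finite {X : Type*} [Fintype X] (P L f : X → ℝ)
    (hP : ∀ x, 0 ≤ P x) (hP1 : ∑ x, P x = 1) (hQ1 : ∑ x, P x * Real.exp (-L x) = 1)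
    (hf0 : ∀ x, 0 ≤ f x) (hf1 : ∀ x, f x ≤ 1) :
    1 / 2 * Real.exp (-∑ x, P x * L x) ≤
      ∑ x, P x * f x + ∑ x, P x * Real.exp (-L x) * (1 - f x) := by
  set Q : X → ℝ := fun x => P x * Real.exp (-L x) with hQdef
  have hQ : ∀ x, 0 ≤ Q x := fun x => mul_nonneg (hP x) (Real.exp_pos _).le
  have hmin : ∑ x, min (P x) (Q x) ≤ ∑ x, P x * f x + ∑ x, Q x * (1 - f x) := by
    rw [← Finset.sum_add_distrib]
    refine Finset.sum_le_sum fun x _ => ?_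
    have h1 := mul_le_mul_of_nonneg_right (min_le_left (P x) (Q x)) (hf0 x)
    have h2 := mul_le_mul_of_nonneg_right (min_le_right (P x) (Q x)) (sub_nonneg.2 (hf1 x))
    linarith
  have hmax : ∑ x, max (P x) (Q x) ≤ 2 := by
    calc ∑ x, max (P x) (Q x) ≤ ∑ x, (P x + Q x) :=
          Finset.sum_le_sum fun x _ => max_le_add_of_nonneg (hP x) (hQ x)
      _ = 2 := by rw [Finset.sum_add_distrib, hP1, hQ1]; norm_num
  have hjensen : Real.exp (∑ x, P x * (-L x / 2)) ≤ ∑ x, P x * Real.exp (-L x / 2) := by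
    simpa using convexOn_exp.map_sum_le (t := Finset.univ) (w := P) (p := fun x => -L x / 2)
      (fun x _ => hP x) hP1 (fun x _ => Set.mem_univ _)
  have hprod : ∀ x, (P x * Real.exp (-L x / 2)) ^ 2 = min (P x) (Q x) * max (P x) (Q x) := by
    intro x
    rw [min_mul_max, hQdef, mul_pow, ← Real.exp_nat_mul]
    push_cast
    rw [mul_div_cancel₀ _ (two_ne_zero)]
    ring
  have hcs : (∑ x, P x * Real.exp (-L x / 2)) ^ 2 ≤
      (∑ x, min (P x) (Q x)) * ∑ x, max (P x) (Q x) :=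
    Finset.sum_sq_le_sum_mul_sum_of_sq_le_mul _ (fun x _ => le_min (hP x) (hQ x))
      (fun x _ => le_max_of_le_left (hP x)) (fun x _ => (hprod x).le)
  have hexp : Real.exp (-∑ x, P x * L x) = Real.exp (∑ x, P x * (-L x / 2)) ^ 2 := by
    rw [← Real.exp_nat_mul, ← Finset.sum_neg_distrib, Finset.mul_sum]
    congr 1
    refine Finset.sum_congr rfl fun x _ => ?_
    push_cast
    ring
  have hsq := pow_le_pow_left₀ (Real.exp_pos _).le hjensen 2
  have hmin0 : 0 ≤ ∑ x, min (P x) (Q x) := Finset.sum_nonneg fun x _ => le_min (hP x) (hQ x)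
  have := mul_le_mul_of_nonneg_left hmax hmin0
  linarith

/-- Probability of the observation sequence `ys` when the query rule is `q` and the bits
are `θ`. -/
noncomputable def obsProb {K T : ℕ} (p : ℝ) (q : Fin T → (Fin T → Bool) → Fin K)
    (θ : Fin K → Bool) (ys : Fin T → Bool) : ℝ :=
  ∏ t, if ys t = θ (q t ys) then 1 - p else p

/-- A query rule is predictable if each query depends only on earlier observations. -/
def IsPredictable {K T : ℕ} (q : Fin T → (Fin T → Bool) → Fin K) : Prop :=
  ∀ (t : Fin T) (ys ys' : Fin T → Bool),
    (∀ s : Fin T, (s : ℕ) < (t : ℕ) → ys s = ys' s) → q t ys = q t ys'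

/-- Log-likelihood ratio of the all-zero bits against the bits with a single one at `k`. -/
noncomputable def llr {K T : ℕ} (p : ℝ) (q : Fin T → (Fin T → Bool) → Fin K) (k : Fin K)
    (ys : Fin T → Bool) : ℝ :=
  ∑ t, if q t ys = k then
    (if ys t then -Real.log ((1 - p) / p) else Real.log ((1 - p) / p)) else 0

section

variable {K T : ℕ} {p : ℝ} {q : Fin T → (Fin T → Bool) → Fin K}

theorem sum_obsProb (hq : IsPredictable q) (θ : Fin K → Bool) :
    ∑ ys, obsProb p q θ ys = 1 := by
  let e : (Fin T → Bool) → (Fin T → Bool) := fun ys t => xor (ys t) (θ (q t ys))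
  have he : Function.Injective e := by
    intro ys ys' h
    have key : ∀ n : ℕ, ∀ t : Fin T, (t : ℕ) = n → ys t = ys' t := by
      intro n
      induction n using Nat.strong_induction_on with
      | _ n ih =>
        intro t ht
        have h1 : q t ys = q t ys' := hq t ys ys' fun s hs => ih s (ht ▸ hs) s rfl
        have h2 : xor (ys t) (θ (q t ys)) = xor (ys' t) (θ (q t ys')) := congrFun h t
        rw [h1] at h2
        simpa using h2
    exact funext fun t => key t t rfl
  calc ∑ ys, obsProb p q θ ys
      = ∑ ys, ∏ t, (fun b : Bool => if b then p else 1 - p) (e ys t) := by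
        refine Finset.sum_congr rfl fun ys _ => Finset.prod_congr rfl fun t _ => ?_
        have hxor : ∀ a b : Bool, (if a = b then 1 - p else p) = if xor a b then p else 1 - p := by
          intro a b
          cases a <;> cases b <;> simp
        exact hxor _ _
    _ = ∑ ys : Fin T → Bool, ∏ t, (fun b : Bool => if b then p else 1 - p) (ys t) :=
        (Finite.injective_iff_bijective.1 he).sum_comp
          (fun ys => ∏ t, (fun b : Bool => if b then p else 1 - p) (ys t))
    _ = 1 := by
        rw [← Fintype.prod_sum (fun (_ : Fin T) (b : Bool) => if b then p else 1 - p)]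
        simp

theorem obsProb_nonneg (hp0 : 0 < p) (hp1 : p < 1 / 2) (θ : Fin K → Bool) (ys : Fin T → Bool) :
    0 ≤ obsProb p q θ ys :=
  Finset.prod_nonneg fun t _ => by split_ifs <;> linarith

theorem obsProb_single (hp0 : 0 < p) (hp1 : p < 1 / 2) (k : Fin K) (ys : Fin T → Bool) :
    obsProb p q (fun j => decide (j = k)) ys =
      obsProb p q (fun _ => false) ys * Real.exp (-llr p q k ys) := by
  have h1p : 0 < 1 - p := by linarith
  rw [obsProb, obsProb, llr, ← Finset.sum_neg_distrib, Real.exp_sum, ← Finset.prod_mul_distrib]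
  refine Finset.prod_congr rfl fun t _ => ?_
  by_cases h : q t ys = k
  · cases hy : ys t
    · simp [h, Real.exp_neg, Real.exp_log (div_pos h1p hp0)]
      field_simp
    · simp [h, Real.exp_log (div_pos h1p hp0)]
      field_simp
  · simp [h]

theorem sum_obsProb_mul_llr (hq : IsPredictable q) (k : Fin K) :
    ∑ ys, obsProb p q (fun _ => false) ys * llr p q k ys =
      ∑ ys, obsProb p q (fun _ => false) ys * ∑ t, if q t ys = k then klBer p else 0 := by
  simp only [llr, Finset.mul_sum]
  rw [Finset.sum_comm, Finset.sum_comm (s := Finset.univ) (t := Finset.univ)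
    (f := fun ys t => obsProb p q (fun _ => false) ys * if q t ys = k then klBer p else 0)]
  refine Finset.sum_congr rfl fun t _ => ?_
  rw [← sub_eq_zero, ← Finset.sum_sub_distrib]
  have hflip : ∀ ys : Fin T → Bool, q t (Function.update ys t (!ys t)) = q t ys := fun ys =>
    hq t _ _ fun s hs => Function.update_of_ne (by rintro rfl; exact lt_irrefl _ hs) _ _
  refine Finset.sum_involution (fun ys _ => Function.update ys t (!ys t)) ?_ ?_ ?_ ?_
  · intro ys _
    rw [hflip]
    by_cases h : q t ys = k
    · have hrest : ∏ s ∈ Finset.univ.erase t,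
          (if Function.update ys t (!ys t) s = false then 1 - p else p) =
          ∏ s ∈ Finset.univ.erase t, (if ys s = false then 1 - p else p) :=
        Finset.prod_congr rfl fun s hs => by
          rw [Function.update_of_ne (Finset.ne_of_mem_erase hs)]
      simp only [obsProb]
      rw [← Finset.mul_prod_erase _ _ (Finset.mem_univ t),
        ← Finset.mul_prod_erase (a := t) Finset.univ
          (fun s => if Function.update ys t (!ys t) s = false then 1 - p else p)
          (Finset.mem_univ t), hrest, Function.update_self, klBer]
      cases ys t <;> simp [h] <;> ring
    · simp [h]
  · intro ys _ _ h
    have := congrFun h t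
    simp at this
  · intro ys _
    exact Finset.mem_univ _
  · intro ys _
    simp

theorem detErrOR_zero (out : (Fin T → Bool) → Bool) :
    detErrOR K T p q out (fun _ => false) =
      ∑ ys, obsProb p q (fun _ => false) ys * (if out ys then 1 else 0) := by
  refine Finset.sum_congr rfl fun ys _ => ?_
  have : orFun (fun _ : Fin K => false) = false := by simp [orFun]
  rw [this, obsProb]
  cases out ys <;> simp

theorem detErrOR_single (hp0 : 0 < p) (hp1 : p < 1 / 2) (k : Fin K)
    (out : (Fin T → Bool) → Bool) :
    detErrOR K T p q out (fun j => decide (j = k)) =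
      ∑ ys, obsProb p q (fun _ => false) ys * Real.exp (-llr p q k ys) *
        (1 - if out ys then 1 else 0) := by
  refine Finset.sum_congr rfl fun ys _ => ?_
  have : orFun (fun j : Fin K => decide (j = k)) = true := by simp [orFun]
  rw [this, ← obsProb_single hp0 hp1, obsProb]
  cases out ys <;> simp

end

theorem klBer_pos {p : ℝ} (hp0 : 0 < p) (hp1 : p < 1 / 2) : 0 < klBer p :=
  mul_pos (by linarith) (Real.log_pos ((one_lt_div hp0).2 (by linarith)))

theorem exists_le_sum_detErrOR
    (K T : ℕ) (hK : 1 ≤ K) (p : ℝ) (hp0 : 0 < p) (hp1 : p < 1 / 2)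
    (Ω : Type) [Fintype Ω] (w : Ω → ℝ) (hw0 : ∀ ω, 0 ≤ w ω) (hw1 : ∑ ω, w ω = 1)
    (q : Ω → Fin T → (Fin T → Bool) → Fin K) (hq : ∀ ω, IsPredictable (q ω))
    (out : Ω → (Fin T → Bool) → Bool) :
    ∃ θ : Fin K → Bool, (1 / 4 : ℝ) * Real.exp (-((T : ℝ) * klBer p) / K) ≤
      ∑ ω, w ω * detErrOR K T p (q ω) (out ω) θ := by
  have hK0 : (0 : ℝ) < K := by exact_mod_cast hK
  let P : Ω × (Fin T → Bool) → ℝ := fun x => w x.1 * obsProb p (q x.1) (fun _ => false) x.2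
  have hP1 : ∑ x, P x = 1 := by
    simp only [P, Fintype.sum_prod_type, ← Finset.mul_sum, sum_obsProb (hq _), mul_one, hw1]
  obtain ⟨k, hk⟩ : ∃ k : Fin K, ∑ x, P x * llr p (q x.1) k x.2 ≤ T * klBer p / K := by
    have hsum : ∑ k : Fin K, ∑ x, P x * llr p (q x.1) k x.2 = T * klBer p := by
      have h1 : ∀ k : Fin K, ∑ x, P x * llr p (q x.1) k x.2 =
          ∑ x, P x * ∑ t, if q x.1 t x.2 = k then klBer p else 0 := by
        intro k
        simp only [P, Fintype.sum_prod_type, mul_assoc]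
        refine Finset.sum_congr rfl fun ω _ => ?_
        rw [← Finset.mul_sum, ← Finset.mul_sum, sum_obsProb_mul_llr (hq ω)]
      simp only [h1]
      rw [Finset.sum_comm]
      simp only [← Finset.mul_sum]
      have h2 : ∀ x : Ω × (Fin T → Bool),
          (∑ k : Fin K, ∑ t, if q x.1 t x.2 = k then klBer p else 0) = T * klBer p := by
        intro x
        rw [Finset.sum_comm]
        simp
      simp only [h2]
      rw [← Finset.sum_mul, hP1, one_mul]
    have : Nonempty (Fin K) := ⟨⟨0, hK⟩⟩
    obtain ⟨k, -, hk⟩ := Finset.exists_le_of_sum_le (s := (Finset.univ : Finset (Fin K)))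
      (f := fun k => ∑ x, P x * llr p (q x.1) k x.2) (g := fun _ => T * klBer p / K)
      Finset.univ_nonempty (by
        rw [hsum]
        simp
        field_simp
        exact le_rfl)
    exact ⟨k, hk⟩
  have hQ1 : ∑ x, P x * Real.exp (-llr p (q x.1) k x.2) = 1 := by
    simp only [P, Fintype.sum_prod_type, mul_assoc, ← obsProb_single hp0 hp1, ← Finset.mul_sum,
      sum_obsProb (hq _), mul_one, hw1]
  have hbh := bretagnolle_huber_finite P (fun x => llr p (q x.1) k x.2)
    (fun x => if out x.1 x.2 then 1 else 0)
    (fun x => mul_nonneg (hw0 _) (obsProb_nonneg hp0 hp1 _ _)) hP1 hQ1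
    (fun x => by split_ifs <;> norm_num) (fun x => by split_ifs <;> norm_num)
  have hE0 : ∑ ω, w ω * detErrOR K T p (q ω) (out ω) (fun _ => false) =
      ∑ x, P x * (if out x.1 x.2 then 1 else 0) := by
    simp only [P, Fintype.sum_prod_type, mul_assoc, detErrOR_zero, Finset.mul_sum]
  have hE1 : ∑ ω, w ω * detErrOR K T p (q ω) (out ω) (fun j => decide (j = k)) =
      ∑ x, P x * Real.exp (-llr p (q x.1) k x.2) * (1 - if out x.1 x.2 then 1 else 0) := by
    simp only [P, Fintype.sum_prod_type, mul_assoc, detErrOR_single hp0 hp1, Finset.mul_sum]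
  rw [← hE0, ← hE1] at hbh
  have hexp : Real.exp (-((T : ℝ) * klBer p) / K) ≤
      Real.exp (-∑ x, P x * llr p (q x.1) k x.2) :=
    Real.exp_le_exp.2 (by rw [neg_div]; exact neg_le_neg hk)
  by_contra! hlt
  have h0 := hlt fun _ => false
  have h1 := hlt fun j => decide (j = k)
  linarith

/-- Lower bound for adaptively computing the OR of `K` noisy bits.  Any (possibly
randomized, via a seed `ω` drawn with probability `w ω`) adaptive `T`-round algorithm
has worst-case error probability at least `(1/4)·exp(-T·D_KL(p‖1-p)/K)`; consequently,
if its worst-case error probability is at most `δ < 1/4` then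
`T ≥ K·ln(1/(4δ))/D_KL(p‖1-p)`. -/
theorem or_adaptive_lower_bound
    (K T : ℕ) (hK : 1 ≤ K) (p : ℝ) (hp0 : 0 < p) (hp1 : p < 1 / 2)
    (Ω : Type) [Fintype Ω] (w : Ω → ℝ) (hw0 : ∀ ω, 0 ≤ w ω) (hw1 : ∑ ω, w ω = 1)
    (q : Ω → Fin T → (Fin T → Bool) → Fin K)
    (hq : ∀ (ω : Ω) (t : Fin T) (ys ys' : Fin T → Bool),
      (∀ s : Fin T, (s : ℕ) < (t : ℕ) → ys s = ys' s) → q ω t ys = q ω t ys')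
    (out : Ω → (Fin T → Bool) → Bool) :
    (1 / 4 : ℝ) * Real.exp (-((T : ℝ) * klBer p) / K) ≤
        (⨆ θ : Fin K → Bool, ∑ ω, w ω * detErrOR K T p (q ω) (out ω) θ) ∧
      ∀ δ : ℝ, 0 < δ → δ < 1 / 4 →
        (∀ θ : Fin K → Bool, ∑ ω, w ω * detErrOR K T p (q ω) (out ω) θ ≤ δ) →
        (K : ℝ) * Real.log (1 / (4 * δ)) / klBer p ≤ (T : ℝ) := by
  obtain ⟨θ, hθ⟩ := exists_le_sum_detErrOR K T hK p hp0 hp1 Ω w hw0 hw1 q hq out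
  refine ⟨hθ.trans (le_ciSup (f := fun θ : Fin K → Bool =>
    ∑ ω, w ω * detErrOR K T p (q ω) (out ω) θ) (Set.finite_range _).bddAbove θ), ?_⟩
  intro δ hδ0 _ hδ
  have hK0 : (0 : ℝ) < K := by exact_mod_cast hK
  have hle : Real.exp (-((T : ℝ) * klBer p) / K) ≤ 4 * δ := by linarith [hδ θ]
  have hlog := (Real.le_log_iff_exp_le (by linarith)).2 hle
  rw [div_le_iff₀ (klBer_pos hp0 hp1), one_div, Real.log_inv]
  rw [div_le_iff₀ hK0] at hlog
  linarith
end

section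
/- For every K ≥ 1, p ∈ (0,1/2) and T ≥ 0, any non-adaptive T-round algorithm for computing the OR of K noisy bits satisfies sup over θ ∈ {0,1}^K of P(μ̂ ≠ OR(θ)) ≥ (1/2)·(1 − sqrt( (1/(2K))·( (1 + (1−2p)²/(K·(1−p)·p))^T − 1 ) )). -/
/-- Error probability of a non-adaptive `T`-round strategy for computing the OR of `K`
noisy bits when the true bits are `θ`.  The strategy fixes in advance a sequence of
distributions `π t` over indices `{1,…,K}`; at round `t` an index `ks t` is drawn from
`π t` independently of everything else, and an observation `ys t` equal to `θ (ks t)`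
flipped independently with probability `p` is received.  After `T` rounds, the output
rule `out` sees the queried indices and the observations.  The error probability is
the total probability of the pairs `(ks, ys)` on which the output disagrees with
`OR(θ)`. -/
noncomputable def naErrOR (K T : ℕ) (p : ℝ)
    (π : Fin T → Fin K → ℝ)
    (out : (Fin T → Fin K) → (Fin T → Bool) → Bool) (θ : Fin K → Bool) : ℝ :=
  ∑ ks : Fin T → Fin K, ∑ ys : Fin T → Bool,
    (∏ t : Fin T, π t (ks t) * (if ys t = θ (ks t) then 1 - p else p)) *
      (if out ks ys = orFun θ then 0 else 1)

/-- A test between a probability weight `P` and its reweighting `P * L` has total error at least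
`1 - √χ² / 2`, where `χ²` is the second moment of `L - 1`. -/
lemma one_sub_half_sqrt_le_test_error {Z : Type*} [Fintype Z] (P L : Z → ℝ) (d : Z → Bool)
    (hP : ∀ z, 0 ≤ P z) (hP1 : ∑ z, P z = 1) (hL1 : ∑ z, P z * L z = 1) :
    1 - √(∑ z, P z * (L z - 1) ^ 2) / 2 ≤
      ∑ z, (P z * (if d z = false then 0 else 1) + P z * L z * (if d z = true then 0 else 1)) := by
  have hcs : ∑ z, P z * |L z - 1| ≤ √(∑ z, P z * (L z - 1) ^ 2) := by
    apply Real.le_sqrt_of_sq_le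
    have h := Finset.sum_sq_le_sum_mul_sum_of_sq_le_mul (s := Finset.univ)
      (r := fun z => P z * |L z - 1|) (f := P) (g := fun z => P z * (L z - 1) ^ 2)
      (fun z _ => hP z) (fun z _ => mul_nonneg (hP z) (sq_nonneg _))
      (fun z _ => by rw [mul_pow, sq_abs]; exact le_of_eq (by ring))
    rwa [hP1, one_mul] at h
  have hsum : ∑ z, (P z + P z * L z - P z * |L z - 1|) / 2
      = 1 - (∑ z, P z * |L z - 1|) / 2 := by
    rw [← Finset.sum_div, Finset.sum_sub_distrib, Finset.sum_add_distrib, hP1, hL1]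
    ring
  have hpt : ∑ z, (P z + P z * L z - P z * |L z - 1|) / 2 ≤
      ∑ z, (P z * (if d z = false then 0 else 1)
        + P z * L z * (if d z = true then 0 else 1)) := by
    refine Finset.sum_le_sum fun z _ => ?_
    have h1 := mul_le_mul_of_nonneg_left (le_abs_self (L z - 1)) (hP z)
    have h2 := mul_le_mul_of_nonneg_left (neg_abs_le (L z - 1)) (hP z)
    cases d z <;> simp <;> linarith
  linarith

/-- Product weights over pairs of sequences factor round by round. -/
lemma sum_sum_prod_eq_prod_sum_sum {T : ℕ} {α β : Type*} [Fintype α] [Fintype β]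
    (u : Fin T → α → β → ℝ) :
    ∑ z : (Fin T → α) × (Fin T → β), ∏ t, u t (z.1 t) (z.2 t) = ∏ t, ∑ a, ∑ b, u t a b := by
  classical
  rw [Fintype.sum_prod_type, Finset.prod_univ_sum, Fintype.piFinset_univ]
  refine Finset.sum_congr rfl fun ks _ => ?_
  rw [Finset.prod_univ_sum, Fintype.piFinset_univ]

/-- The likelihood ratio of one observation `y` of the `k`-th bit between the bit vector with
the single one `j` and the zero vector. -/
noncomputable def likelihoodRatio {K : ℕ} (p : ℝ) (j k : Fin K) (y : Bool) : ℝ :=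
  if k = j then (if y = true then (1 - p) / p else p / (1 - p)) else 1

/-- The weight of a transcript of queries and observations under the zero vector. -/
noncomputable def nullWeight {K T : ℕ} (p : ℝ) (π : Fin T → Fin K → ℝ)
    (z : (Fin T → Fin K) × (Fin T → Bool)) : ℝ :=
  ∏ t, π t (z.1 t) * (if z.2 t = false then 1 - p else p)

/-- The likelihood ratio of a transcript. -/
noncomputable def transcriptRatio {K T : ℕ} (p : ℝ) (j : Fin K)
    (z : (Fin T → Fin K) × (Fin T → Bool)) : ℝ :=
  ∏ t, likelihoodRatio p j (z.1 t) (z.2 t)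

lemma naErrOR_zero {K T : ℕ} (p : ℝ) (π : Fin T → Fin K → ℝ)
    (out : (Fin T → Fin K) → (Fin T → Bool) → Bool) :
    naErrOR K T p π out (fun _ => false) =
      ∑ z, nullWeight p π z * (if out z.1 z.2 = false then 0 else 1) := by
  rw [Fintype.sum_prod_type]
  simp [naErrOR, nullWeight, orFun]

lemma naErrOR_single {K T : ℕ} {p : ℝ} (hp0 : 0 < p) (hp1 : p < 1 / 2)
    (π : Fin T → Fin K → ℝ) (out : (Fin T → Fin K) → (Fin T → Bool) → Bool) (j : Fin K) :
    naErrOR K T p π out (fun k => decide (k = j)) =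
      ∑ z, nullWeight p π z * transcriptRatio p j z *
        (if out z.1 z.2 = true then 0 else 1) := by
  have hq : 1 - p ≠ 0 := by linarith
  have hor : orFun (fun k : Fin K => decide (k = j)) = true := by simp [orFun]
  rw [Fintype.sum_prod_type]
  simp only [naErrOR, hor, nullWeight, transcriptRatio, ← Finset.prod_mul_distrib]
  refine Finset.sum_congr rfl fun ks _ => Finset.sum_congr rfl fun ys _ => ?_
  congr 1
  refine Finset.prod_congr rfl fun t _ => ?_
  rw [mul_assoc]
  congr 1
  rcases Bool.eq_false_or_eq_true (ys t) with hy | hy <;> by_cases h : ks t = j <;>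
    simp [likelihoodRatio, h, hy] <;> field_simp

lemma nullWeight_nonneg {K T : ℕ} {p : ℝ} (hp0 : 0 < p) (hp1 : p < 1 / 2)
    {π : Fin T → Fin K → ℝ} (hπ0 : ∀ t k, 0 ≤ π t k)
    (z : (Fin T → Fin K) × (Fin T → Bool)) : 0 ≤ nullWeight p π z := by
  refine Finset.prod_nonneg fun t _ => mul_nonneg (hπ0 _ _) ?_
  split_ifs <;> linarith

lemma sum_nullWeight {K T : ℕ} (p : ℝ) {π : Fin T → Fin K → ℝ}
    (hπ1 : ∀ t, ∑ k, π t k = 1) : ∑ z, nullWeight p π z = 1 := by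
  unfold nullWeight
  rw [sum_sum_prod_eq_prod_sum_sum
    (fun t k y => π t k * (if y = false then 1 - p else p))]
  refine Finset.prod_eq_one fun t _ => ?_
  refine (Finset.sum_congr rfl fun k _ => ?_).trans (hπ1 t)
  simp
  ring

lemma sum_nullWeight_mul_transcriptRatio {K T : ℕ} {p : ℝ} (hp0 : 0 < p) (hp1 : p < 1 / 2)
    {π : Fin T → Fin K → ℝ} (hπ1 : ∀ t, ∑ k, π t k = 1) (j : Fin K) :
    ∑ z, nullWeight p π z * transcriptRatio p j z = 1 := by
  have hq : 1 - p ≠ 0 := by linarith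
  simp only [nullWeight, transcriptRatio, ← Finset.prod_mul_distrib]
  rw [sum_sum_prod_eq_prod_sum_sum
    (fun t k y => π t k * (if y = false then 1 - p else p) * likelihoodRatio p j k y)]
  refine Finset.prod_eq_one fun t _ => ?_
  refine (Finset.sum_congr rfl fun k _ => ?_).trans (hπ1 t)
  by_cases h : k = j <;> simp [likelihoodRatio, h] <;> field_simp <;> ring

lemma sum_nullWeight_mul_transcriptRatio_mul {K T : ℕ} {p : ℝ} (hp0 : 0 < p) (hp1 : p < 1 / 2)
    {π : Fin T → Fin K → ℝ} (hπ1 : ∀ t, ∑ k, π t k = 1) (i j : Fin K) :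
    ∑ z, nullWeight p π z * transcriptRatio p i z * transcriptRatio p j z =
      if i = j then ∏ t, (1 + (1 - 2 * p) ^ 2 / ((1 - p) * p) * π t j) else 1 := by
  have hq : 1 - p ≠ 0 := by linarith
  simp only [nullWeight, transcriptRatio, ← Finset.prod_mul_distrib]
  rw [sum_sum_prod_eq_prod_sum_sum (fun t k y => π t k * (if y = false then 1 - p else p) *
    likelihoodRatio p i k y * likelihoodRatio p j k y)]
  split_ifs with hij
  · subst hij
    refine Finset.prod_congr rfl fun t _ => ?_
    have h : ∀ k, ∑ y, π t k * (if y = false then 1 - p else p) *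
        likelihoodRatio p i k y * likelihoodRatio p i k y =
        π t k + if k = i then (1 - 2 * p) ^ 2 / ((1 - p) * p) * π t k else 0 := by
      intro k
      by_cases h : k = i <;> simp [likelihoodRatio, h] <;> field_simp <;> ring
    simp only [h, Finset.sum_add_distrib, hπ1, Finset.sum_ite_eq', Finset.mem_univ, if_true]
  · refine Finset.prod_eq_one fun t _ => ?_
    refine (Finset.sum_congr rfl fun k _ => ?_).trans (hπ1 t)
    by_cases h : k = i
    · have h' : k ≠ j := fun e => hij (h.symm.trans e)
      simp only [likelihoodRatio, h, if_neg hij, Fintype.sum_bool]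
      simp
      field_simp
      ring
    · by_cases h' : k = j <;> simp [likelihoodRatio, h, h', Ne.symm hij] <;> field_simp <;> ring

/-- The `χ²`-divergence from the zero vector to a mixture of single ones. -/
lemma sum_nullWeight_mul_mixture_sub_one_sq {K T : ℕ} {p : ℝ} (hp0 : 0 < p) (hp1 : p < 1 / 2)
    {π : Fin T → Fin K → ℝ} (hπ1 : ∀ t, ∑ k, π t k = 1) (v : Fin K → ℝ) (hv : ∑ j, v j = 1) :
    ∑ z, nullWeight p π z * ((∑ j, v j * transcriptRatio p j z) - 1) ^ 2 =
      ∑ j, v j ^ 2 * (∏ t, (1 + (1 - 2 * p) ^ 2 / ((1 - p) * p) * π t j) - 1) := by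
  have hexp : ∀ z, nullWeight p π z * ((∑ j, v j * transcriptRatio p j z) - 1) ^ 2 =
      ∑ i, ∑ j, v i * v j * (nullWeight p π z * transcriptRatio p i z * transcriptRatio p j z
        - nullWeight p π z * transcriptRatio p i z - nullWeight p π z * transcriptRatio p j z
        + nullWeight p π z) := by
    intro z
    have h : (∑ j, v j * transcriptRatio p j z) - 1
        = ∑ j, v j * (transcriptRatio p j z - 1) := by
      simp only [mul_sub, Finset.sum_sub_distrib, mul_one, hv]
    rw [h, sq, Finset.sum_mul_sum, Finset.mul_sum]
    refine Finset.sum_congr rfl fun i _ => ?_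
    rw [Finset.mul_sum]
    refine Finset.sum_congr rfl fun j _ => ?_
    ring
  simp only [hexp]
  rw [Finset.sum_comm]
  refine Finset.sum_congr rfl fun i _ => ?_
  rw [Finset.sum_comm]
  simp only [← Finset.mul_sum, Finset.sum_add_distrib, Finset.sum_sub_distrib,
    sum_nullWeight_mul_transcriptRatio_mul hp0 hp1 hπ1,
    sum_nullWeight_mul_transcriptRatio hp0 hp1 hπ1, sum_nullWeight p hπ1]
  rw [Finset.sum_eq_single i]
  · rw [if_pos rfl]
    ring
  · intro j _ hj
    simp [hj.symm]
  · simp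

/-- The tangent line of `s ↦ 1 / (exp s - 1)`, written in terms of `u = exp s`. -/
lemma inv_sub_one_tangent {u M : ℝ} (hu : 1 < u) (hM : 1 < M) :
    (M - 1)⁻¹ - M / (M - 1) ^ 2 * (Real.log u - Real.log M) ≤ (u - 1)⁻¹ := by
  have hu' : 0 < u - 1 := by linarith
  have hM' : 0 < M - 1 := by linarith
  have hM0 : 0 < M := by linarith
  have hr : 0 < (u - 1) / (M - 1) := div_pos hu' hM'
  have hconc := strictConcaveOn_log_Ioi.concaveOn.2 (Set.mem_Ioi.2 one_pos) (Set.mem_Ioi.2 hr)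
    (inv_pos.2 hM0).le (div_pos hM' hM0).le (by field_simp; ring)
  have hcomb : M⁻¹ • (1 : ℝ) + ((M - 1) / M) • ((u - 1) / (M - 1)) = u / M := by
    simp only [smul_eq_mul]
    field_simp
    ring
  rw [hcomb, Real.log_one, Real.log_div (by linarith) hM0.ne'] at hconc
  simp only [smul_eq_mul, mul_zero, zero_add] at hconc
  have hlog := Real.one_sub_inv_le_log_of_pos hr
  have h1 := mul_le_mul_of_nonneg_left hlog (div_pos hM' hM0).le
  have h2 := mul_le_mul_of_nonneg_left (h1.trans hconc) (by positivity : 0 ≤ M / (M - 1) ^ 2)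
  have h3 : M / (M - 1) ^ 2 * ((M - 1) / M * (1 - ((u - 1) / (M - 1))⁻¹))
      = (M - 1)⁻¹ - (u - 1)⁻¹ := by
    field_simp
  linarith

/-- If the geometric mean of the `m j` is at most `M`, the harmonic mean of the `m j - 1` is at
most `M - 1`. -/
lemma card_div_le_sum_inv_sub_one {K : ℕ} {m : Fin K → ℝ} {M : ℝ} (hm : ∀ j, 1 < m j)
    (hM : 1 < M) (hlog : ∑ j, Real.log (m j) ≤ K * Real.log M) :
    K / (M - 1) ≤ ∑ j, (m j - 1)⁻¹ := by
  have h := Finset.sum_le_sum fun j (_ : j ∈ Finset.univ) => inv_sub_one_tangent (hm j) hM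
  rw [Finset.sum_sub_distrib, ← Finset.mul_sum, Finset.sum_sub_distrib] at h
  simp only [Finset.sum_const, Finset.card_univ, Fintype.card_fin, nsmul_eq_mul] at h
  have hM' : 0 < M - 1 := by linarith
  have h2 : M / (M - 1) ^ 2 * (∑ j, Real.log (m j) - K * Real.log M) ≤ 0 :=
    mul_nonpos_of_nonneg_of_nonpos (by positivity) (by linarith)
  rw [div_eq_mul_inv]
  linarith

lemma sum_log_prod_le {K T : ℕ} (hK : 1 ≤ K) {c : ℝ} (hc : 0 < c) {π : Fin T → Fin K → ℝ}
    (hπ0 : ∀ t k, 0 ≤ π t k) (hπ1 : ∀ t, ∑ k, π t k = 1) :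
    ∑ j, Real.log (∏ t, (1 + c * π t j)) ≤ K * Real.log ((1 + c / K) ^ T) := by
  have hK0 : (0 : ℝ) < K := by exact_mod_cast hK
  have hpos : ∀ t j, 0 < 1 + c * π t j := fun t j => by
    have := mul_nonneg hc.le (hπ0 t j)
    linarith
  have hb : 0 < 1 + c / K := by positivity
  have hround : ∀ t, ∑ j, Real.log (1 + c * π t j) ≤ K * Real.log (1 + c / K) := by
    intro t
    have htan : ∀ j, Real.log (1 + c * π t j) ≤
        Real.log (1 + c / K) + ((1 + c * π t j) / (1 + c / K) - 1) := by
      intro j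
      have h := Real.log_le_sub_one_of_pos (div_pos (hpos t j) hb)
      rw [Real.log_div (hpos t j).ne' hb.ne'] at h
      linarith
    refine (Finset.sum_le_sum fun j _ => htan j).trans (le_of_eq ?_)
    rw [Finset.sum_add_distrib, Finset.sum_sub_distrib, ← Finset.sum_div,
      Finset.sum_add_distrib, ← Finset.mul_sum, hπ1 t]
    simp only [Finset.sum_const, Finset.card_univ, Fintype.card_fin, nsmul_eq_mul]
    have : ((K : ℝ) * 1 + c * 1) / (1 + c / K) = K := by
      field_simp
    rw [this]
    ring
  simp only [Real.log_prod fun t _ => (hpos t _).ne']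
  rw [Finset.sum_comm, Real.log_pow]
  refine (Finset.sum_le_sum fun t _ => hround t).trans (le_of_eq ?_)
  simp only [Finset.sum_const, Finset.card_univ, Fintype.card_fin, nsmul_eq_mul]
  ring

/-- There is a prior on the single ones whose `χ²`-divergence is at most that of the uniform
prior under uniform sampling. -/
lemma exists_prior {K T : ℕ} (hK : 1 ≤ K) {c : ℝ} (hc : 0 < c) {π : Fin T → Fin K → ℝ}
    (hπ0 : ∀ t k, 0 ≤ π t k) (hπ1 : ∀ t, ∑ k, π t k = 1) :
    ∃ v : Fin K → ℝ, (∀ j, 0 ≤ v j) ∧ ∑ j, v j = 1 ∧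
      ∑ j, v j ^ 2 * (∏ t, (1 + c * π t j) - 1) ≤ ((1 + c / K) ^ T - 1) / K := by
  have hK0 : (0 : ℝ) < K := by exact_mod_cast hK
  have hlog := sum_log_prod_le hK hc hπ0 hπ1
  have hm1 : ∀ j, 1 ≤ ∏ t, (1 + c * π t j) := fun j =>
    Finset.one_le_prod fun t _ => by
      have := mul_nonneg hc.le (hπ0 t j)
      linarith
  have hM1 : 1 ≤ (1 + c / (K : ℝ)) ^ T := one_le_pow₀ (by have := div_pos hc hK0; linarith)
  generalize (1 + c / (K : ℝ)) ^ T = M at hlog hM1 ⊢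
  by_cases hex : ∃ j, ∏ t, (1 + c * π t j) = 1
  · obtain ⟨i, hi⟩ := hex
    refine ⟨Pi.single i 1, fun j => ?_, by simp, ?_⟩
    · by_cases h : j = i
      · subst h
        simp
      · simp [h]
    · rw [Finset.sum_eq_single i]
      · rw [hi, sub_self, mul_zero]
        exact div_nonneg (by linarith) hK0.le
      · intro j _ hj
        simp [hj]
      · simp
  push Not at hex
  have hm : ∀ j, 1 < ∏ t, (1 + c * π t j) := fun j => lt_of_le_of_ne (hm1 j) (hex j).symm
  generalize hmdef : (fun j => ∏ t, (1 + c * π t j)) = m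
  have hmj : ∀ j, ∏ t, (1 + c * π t j) = m j := fun j => congrFun hmdef j
  simp only [hmj] at hm hlog ⊢
  have hne : (Finset.univ : Finset (Fin K)).Nonempty := ⟨⟨0, hK⟩, Finset.mem_univ _⟩
  have hM : 1 < M := by
    have h := (Finset.sum_pos (fun j _ => Real.log_pos (hm j)) hne).trans_le hlog
    exact (Real.log_pos_iff (by linarith)).1 (pos_of_mul_pos_right h hK0.le)
  have hM' : 0 < M - 1 := by linarith
  have hS := card_div_le_sum_inv_sub_one hm hM hlog
  have hinv : ∀ j, 0 < (m j - 1)⁻¹ := fun j => inv_pos.2 (by linarith [hm j])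
  have hS0 : 0 < ∑ j, (m j - 1)⁻¹ := Finset.sum_pos (fun j _ => hinv j) hne
  generalize hSdef : ∑ j, (m j - 1)⁻¹ = S at hS hS0
  refine ⟨fun j => (m j - 1)⁻¹ / S, fun j => (div_pos (hinv j) hS0).le, ?_, ?_⟩
  · rw [← Finset.sum_div, hSdef, div_self hS0.ne']
  · have hterm : ∀ j, ((m j - 1)⁻¹ / S) ^ 2 * (m j - 1) = (m j - 1)⁻¹ / S ^ 2 := by
      intro j
      have : m j - 1 ≠ 0 := by linarith [hm j]
      field_simp
    simp only [hterm]
    rw [← Finset.sum_div, hSdef]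
    calc S / S ^ 2 = S⁻¹ := by field_simp
      _ ≤ (K / (M - 1))⁻¹ := inv_anti₀ (by positivity) hS
      _ = (M - 1) / K := inv_div _ _

/-- The error under the zero vector plus the average error under a prior on single ones. -/
lemma one_sub_half_sqrt_le_naErrOR_add {K T : ℕ} {p : ℝ} (hp0 : 0 < p) (hp1 : p < 1 / 2)
    {π : Fin T → Fin K → ℝ} (hπ0 : ∀ t k, 0 ≤ π t k) (hπ1 : ∀ t, ∑ k, π t k = 1)
    (out : (Fin T → Fin K) → (Fin T → Bool) → Bool) (v : Fin K → ℝ) (hv : ∑ j, v j = 1) :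
    1 - √(∑ j, v j ^ 2 * (∏ t, (1 + (1 - 2 * p) ^ 2 / ((1 - p) * p) * π t j) - 1)) / 2 ≤
      naErrOR K T p π out (fun _ => false) +
        ∑ j, v j * naErrOR K T p π out (fun k => decide (k = j)) := by
  have hmix : ∑ z, nullWeight p π z * ∑ j, v j * transcriptRatio p j z = 1 := by
    simp only [Finset.mul_sum]
    rw [Finset.sum_comm]
    simp only [mul_left_comm _ (v _), ← Finset.mul_sum,
      sum_nullWeight_mul_transcriptRatio hp0 hp1 hπ1, mul_one, hv]
  have h := one_sub_half_sqrt_le_test_error (nullWeight p π)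
    (fun z => ∑ j, v j * transcriptRatio p j z) (fun z => out z.1 z.2)
    (nullWeight_nonneg hp0 hp1 hπ0) (sum_nullWeight p hπ1) hmix
  rw [sum_nullWeight_mul_mixture_sub_one_sq hp0 hp1 hπ1 v hv, Finset.sum_add_distrib] at h
  refine h.trans (le_of_eq ?_)
  rw [naErrOR_zero]
  simp only [naErrOR_single hp0 hp1, Finset.mul_sum]
  congr 1
  rw [Finset.sum_comm]
  refine Finset.sum_congr rfl fun z _ => ?_
  rw [Finset.sum_mul]
  refine Finset.sum_congr rfl fun j _ => ?_
  ring

/-- Lower bound for non-adaptively computing the OR of `K` noisy bits: any (possibly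
randomized, via a seed `ω` for the output rule) non-adaptive `T`-round algorithm has
worst-case error probability at least
`(1/2)·(1 - sqrt((1/(2K))·((1 + (1-2p)²/(K(1-p)p))^T - 1)))`. -/
theorem or_nonadaptive_lower_bound
    (K T : ℕ) (hK : 1 ≤ K) (p : ℝ) (hp0 : 0 < p) (hp1 : p < 1 / 2)
    (π : Fin T → Fin K → ℝ) (hπ0 : ∀ t k, 0 ≤ π t k) (hπ1 : ∀ t, ∑ k, π t k = 1)
    (Ω : Type) [Fintype Ω] (w : Ω → ℝ) (hw0 : ∀ ω, 0 ≤ w ω) (hw1 : ∑ ω, w ω = 1)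
    (out : Ω → (Fin T → Fin K) → (Fin T → Bool) → Bool) :
    (1 / 2 : ℝ) *
        (1 - Real.sqrt ((1 / (2 * (K : ℝ))) *
          ((1 + (1 - 2 * p) ^ 2 / ((K : ℝ) * (1 - p) * p)) ^ T - 1))) ≤
      ⨆ θ : Fin K → Bool, ∑ ω, w ω * naErrOR K T p π (out ω) θ := by
  have hK0 : (0 : ℝ) < K := by exact_mod_cast hK
  have hc : 0 < (1 - 2 * p) ^ 2 / ((1 - p) * p) :=
    div_pos (pow_pos (by linarith) 2) (mul_pos (by linarith) hp0)
  obtain ⟨v, hv0, hv1, hv⟩ := exists_prior hK hc hπ0 hπ1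
  have hcK : (1 - 2 * p) ^ 2 / ((1 - p) * p) / K = (1 - 2 * p) ^ 2 / (K * (1 - p) * p) := by
    rw [div_div]
    congr 1
    ring
  rw [hcK] at hv
  set D := (1 + (1 - 2 * p) ^ 2 / ((K : ℝ) * (1 - p) * p)) ^ T - 1
  have hD : 0 ≤ D := sub_nonneg.2 (one_le_pow₀ (by
    rw [← hcK]
    linarith [div_pos hc hK0]))
  have hsqrt : √(∑ j, v j ^ 2 *
      (∏ t, (1 + (1 - 2 * p) ^ 2 / ((1 - p) * p) * π t j) - 1)) / 2 ≤ √(1 / (2 * K) * D) := by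
    rw [div_le_iff₀ two_pos]
    refine Real.sqrt_le_iff.2 ⟨by positivity, hv.trans ?_⟩
    rw [mul_pow, Real.sq_sqrt (by positivity)]
    have : 1 / (2 * (K : ℝ)) * D * 2 ^ 2 = D / K + D / K := by
      field_simp
      ring
    linarith [div_nonneg hD hK0.le]
  set R : (Fin K → Bool) → ℝ := fun θ => ∑ ω, w ω * naErrOR K T p π (out ω) θ
  have hsup : ∀ θ, R θ ≤ ⨆ θ, R θ := le_ciSup (Set.finite_range R).bddAbove
  have hlow : 1 - √(1 / (2 * K) * D) ≤
      R (fun _ => false) + ∑ j, v j * R (fun k => decide (k = j)) := by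
    have h := Finset.sum_le_sum fun ω (_ : ω ∈ Finset.univ) => mul_le_mul_of_nonneg_left
      ((sub_le_sub_left hsqrt 1).trans
        (one_sub_half_sqrt_le_naErrOR_add hp0 hp1 hπ0 hπ1 (out ω) v hv1)) (hw0 ω)
    rw [← Finset.sum_mul, hw1, one_mul] at h
    refine h.trans (le_of_eq ?_)
    simp only [R, mul_add, Finset.sum_add_distrib, Finset.mul_sum]
    congr 1
    rw [Finset.sum_comm]
    refine Finset.sum_congr rfl fun j _ => Finset.sum_congr rfl fun ω _ => ?_
    ring
  have hup : ∑ j, v j * R (fun k => decide (k = j)) ≤ ⨆ θ, R θ := by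
    refine (Finset.sum_le_sum fun j _ => mul_le_mul_of_nonneg_left (hsup _) (hv0 j)).trans ?_
    rw [← Finset.sum_mul, hv1, one_mul]
  linarith [hsup (fun _ => false)]
end

section
/- For every K ≥ 1, p ∈ (0,1/2) and δ ∈ (0,1/2): if a non-adaptive T-round algorithm for computing the OR of K noisy bits has worst-case error probability at most δ, i.e. sup over θ ∈ {0,1}^K of P(μ̂ ≠ OR(θ)) ≤ δ, then T ≥ ln(1 + 2K·(1−2δ)²) / ln(1 + (1−2p)²/(K·(1−p)·p)). -/
open Finset in
/-- A sum over pairs of sequences of a product of factors splits into a product of sums. -/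
theorem sum_sum_prod_eq_prod_sum_sum_s2 {τ κ β : Type*} [Fintype τ] [DecidableEq τ] [Fintype κ]
    [Fintype β] (F : τ → κ → β → ℝ) :
    ∑ ks : τ → κ, ∑ ys : τ → β, ∏ t, F t (ks t) (ys t) = ∏ t, ∑ k, ∑ y, F t k y := by
  simp only [Fintype.prod_sum]

open Finset in
/-- Nonnegativity of `𝔼 (φ - ∑ qᵢ gᵢ)²` for an orthogonal family `g`. -/
theorem bessel_quadratic_nonneg {X ι : Type*} [Fintype X] [Fintype ι] [DecidableEq ι]
    (P : X → ℝ) (hP : ∀ x, 0 ≤ P x) (g : ι → X → ℝ) (N : ι → ℝ)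
    (hg : ∀ i j, ∑ x, P x * (g i x * g j x) = if i = j then N i else 0)
    (φ : X → ℝ) (q : ι → ℝ) :
    0 ≤ ∑ x, P x * φ x ^ 2 - 2 * ∑ i, q i * ∑ x, P x * (g i x * φ x)
      + ∑ i, q i ^ 2 * N i := by
  have h0 : 0 ≤ ∑ x, P x * (φ x - ∑ i, q i * g i x) ^ 2 :=
    sum_nonneg fun x _ => mul_nonneg (hP x) (sq_nonneg _)
  have h1 : ∑ i, q i * ∑ x, P x * (g i x * φ x)
      = ∑ x, P x * (φ x * ∑ i, q i * g i x) := by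
    simp only [mul_sum]
    rw [sum_comm]
    exact sum_congr rfl fun x _ => sum_congr rfl fun i _ => by ring
  have h2 : ∑ i, q i ^ 2 * N i = ∑ x, P x * (∑ i, q i * g i x) ^ 2 := by
    have hL : ∀ i, q i ^ 2 * N i = ∑ j, ∑ x, q i * q j * (P x * (g i x * g j x)) := by
      intro i
      simp only [← mul_sum, hg, mul_ite, mul_zero, sum_ite_eq, mem_univ, if_true]
      ring
    have hR : ∀ x, P x * (∑ i, q i * g i x) ^ 2
        = ∑ i, ∑ j, q i * q j * (P x * (g i x * g j x)) := by
      intro x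
      rw [sq, sum_mul_sum, mul_sum]
      refine sum_congr rfl fun i _ => ?_
      rw [mul_sum]
      exact sum_congr rfl fun j _ => by ring
    simp only [hL, hR]
    rw [sum_comm (s := (univ : Finset X))]
    exact sum_congr rfl fun i _ => sum_comm
  rw [h1, h2]
  refine h0.trans_eq ?_
  rw [mul_sum, ← sum_sub_distrib, ← sum_add_distrib]
  exact sum_congr rfl fun x _ => by ring

/-- Tangent-line form of the convexity of `x ↦ 1 / (exp x - 1)`. -/
theorem tangent_le_inv_sub_one {M G : ℝ} (hM : 1 < M) (hG : 1 < G) :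
    1 / (G - 1) - G / (G - 1) ^ 2 * Real.log (M / G) ≤ 1 / (M - 1) := by
  have hM0 : 0 < M - 1 := by linarith
  have hG0 : 0 < G - 1 := by linarith
  have hlog : 1 - (M / G)⁻¹ ≤ Real.log (M / G) :=
    Real.one_sub_inv_le_log_of_pos (by positivity)
  have hc : 0 ≤ G / (G - 1) ^ 2 := by positivity
  have h1 := mul_le_mul_of_nonneg_left hlog hc
  have h2 : 1 / (M - 1) - (1 / (G - 1) - G / (G - 1) ^ 2 * (1 - (M / G)⁻¹))
      = (M - G) ^ 2 / (M * (M - 1) * (G - 1) ^ 2) := by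
    have := hM0.ne'
    have := hG0.ne'
    have : M ≠ 0 := by linarith
    have : G ≠ 0 := by linarith
    field_simp
    ring
  have h3 : 0 ≤ (M - G) ^ 2 / (M * (M - 1) * (G - 1) ^ 2) := by
    have : 0 < M := by linarith
    positivity
  linarith

open Finset in
/-- Jensen's inequality for the concave function `x ↦ log (1 + x * c)` at a probability vector. -/
theorem sum_log_one_add_mul_le {ι : Type*} [Fintype ι] [Nonempty ι] (u : ι → ℝ)
    (hu : ∀ i, 0 ≤ u i) (hu1 : ∑ i, u i = 1) {c : ℝ} (hc : 0 ≤ c) :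
    ∑ i, Real.log (1 + u i * c)
      ≤ Fintype.card ι * Real.log (1 + c / Fintype.card ι) := by
  set n : ℝ := (Fintype.card ι : ℝ) with hn
  have hn0 : 0 < n := by rw [hn]; exact_mod_cast Fintype.card_pos
  set a := 1 + c / n with ha
  have ha0 : 0 < a := by positivity
  have h : ∀ i, Real.log (1 + u i * c) ≤ Real.log a + ((1 + u i * c) / a - 1) := by
    intro i
    have hi : 0 < 1 + u i * c := by have := mul_nonneg (hu i) hc; linarith
    have := Real.log_le_sub_one_of_pos (div_pos hi ha0)
    rw [Real.log_div hi.ne' ha0.ne'] at this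
    linarith
  refine (sum_le_sum fun i _ => h i).trans_eq ?_
  rw [sum_add_distrib, sum_sub_distrib, ← sum_div, sum_add_distrib, ← sum_mul, hu1]
  simp only [sum_const, card_univ, nsmul_eq_mul, ← hn]
  have : (n * 1 + 1 * c) / a = n * 1 := by
    rw [div_eq_iff ha0.ne', ha]; field_simp
  rw [this]; ring

/-- Likelihood ratio of one observation when only bit `j` is set, against all bits unset. -/
noncomputable def singleBitRatio {κ : Type*} [DecidableEq κ] (p : ℝ) (j k : κ) (y : Bool) : ℝ :=
  if k = j then (if y then (1 - p) / p else p / (1 - p)) else 1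

theorem sum_bool_mul_singleBitRatio {κ : Type*} [DecidableEq κ] {p : ℝ} (hp : 0 < p)
    (hp1 : p < 1) (j k : κ) :
    ∑ y : Bool, (if y = false then 1 - p else p) * singleBitRatio p j k y = 1 := by
  have : 1 - p ≠ 0 := by linarith
  have := hp.ne'
  by_cases h : k = j
  · simp [singleBitRatio, h]; field_simp; ring
  · simp [singleBitRatio, h]

theorem sum_bool_mul_singleBitRatio_mul {κ : Type*} [DecidableEq κ] {p : ℝ} (hp : 0 < p)
    (hp1 : p < 1) (i j k : κ) :
    ∑ y : Bool, (if y = false then 1 - p else p) *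
      (singleBitRatio p i k y * singleBitRatio p j k y) =
      1 + if k = i ∧ k = j then (1 - 2 * p) ^ 2 / ((1 - p) * p) else 0 := by
  have : 1 - p ≠ 0 := by linarith
  have := hp.ne'
  by_cases h : k = i <;> by_cases h' : k = j
  · simp only [singleBitRatio, h, ← h', Fintype.sum_bool]; simp; field_simp; ring
  · have := sum_bool_mul_singleBitRatio hp hp1 i k
    simpa [singleBitRatio, h'] using this
  · have := sum_bool_mul_singleBitRatio hp hp1 j k
    simpa [singleBitRatio, h] using this
  · simp [singleBitRatio, h, h']

open Finset in
/-- If a family of alternatives `P * l j` has pairwise uncorrelated likelihood ratios with second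
moments `M j`, a test with errors at most `δ` forces the `χ²` divergences to be large. -/
theorem sum_inv_chiSq_le_of_test {X ι : Type*} [Fintype X] [Fintype ι] [DecidableEq ι]
    (P : X → ℝ) (hP : ∀ x, 0 ≤ P x) (hP1 : ∑ x, P x = 1) (l : ι → X → ℝ) (M : ι → ℝ)
    (hl : ∀ i, ∑ x, P x * l i x = 1)
    (hll : ∀ i j, ∑ x, P x * (l i x * l j x) = if i = j then M i else 1)
    (φ : X → ℝ) (hφ0 : ∀ x, 0 ≤ φ x) (hφ1 : ∀ x, φ x ≤ 1) {δ : ℝ} (hδ0 : 0 < δ)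
    (hδ : δ < 1 / 2) (h0 : ∑ x, P x * φ x ≤ δ) (h1 : ∀ i, 1 - δ ≤ ∑ x, P x * l i x * φ x) :
    (∀ i, 1 < M i) ∧ (1 - 2 * δ) ^ 2 * ∑ i, 1 / (M i - 1) ≤ δ := by
  have ha : 0 < 1 - 2 * δ := by linarith
  have hg : ∀ i j, ∑ x, P x * ((l i x - 1) * (l j x - 1)) = if i = j then M i - 1 else 0 := by
    intro i j
    have : ∑ x, P x * ((l i x - 1) * (l j x - 1)) = ∑ x, P x * (l i x * l j x)
        - ∑ x, P x * l i x - ∑ x, P x * l j x + ∑ x, P x := by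
      rw [← sum_sub_distrib, ← sum_sub_distrib, ← sum_add_distrib]
      exact sum_congr rfl fun x _ => by ring
    rw [this, hll, hl, hl, hP1]
    split_ifs <;> ring
  have hφ : ∑ x, P x * φ x ^ 2 ≤ δ := by
    refine (sum_le_sum fun x _ => mul_le_mul_of_nonneg_left ?_ (hP x)).trans h0
    nlinarith [hφ0 x, hφ1 x]
  have hD : ∀ i, 1 - 2 * δ ≤ ∑ x, P x * ((l i x - 1) * φ x) := by
    intro i
    have : ∑ x, P x * ((l i x - 1) * φ x) = ∑ x, P x * l i x * φ x - ∑ x, P x * φ x := by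
      rw [← sum_sub_distrib]
      exact sum_congr rfl fun x _ => by ring
    linarith [h1 i]
  have key : ∀ q : ι → ℝ, (∀ i, 0 ≤ q i) →
      0 ≤ δ - 2 * ∑ i, q i * (1 - 2 * δ) + ∑ i, q i ^ 2 * (M i - 1) := by
    intro q hq
    have h := bessel_quadratic_nonneg P hP (fun i x => l i x - 1) (fun i => M i - 1) hg φ q
    have h' := sum_le_sum fun i (_ : i ∈ univ) => mul_le_mul_of_nonneg_left (hD i) (hq i)
    linarith
  have hM : ∀ i, 1 < M i := by
    intro i
    by_contra! hle
    have h := key (Pi.single i (δ / (1 - 2 * δ))) (fun j => by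
      by_cases hj : j = i
      · subst hj; simp only [Pi.single_eq_same]; positivity
      · simp [hj])
    rw [sum_eq_single i (by intro j _ hj; simp [hj]) (by simp),
      sum_eq_single i (by intro j _ hj; simp [hj]) (by simp)] at h
    simp only [Pi.single_eq_same, div_mul_cancel₀ _ ha.ne'] at h
    have : (δ / (1 - 2 * δ)) ^ 2 * (M i - 1) ≤ 0 :=
      mul_nonpos_of_nonneg_of_nonpos (sq_nonneg _) (by linarith)
    linarith
  refine ⟨hM, ?_⟩
  have h := key (fun i => (1 - 2 * δ) * (1 / (M i - 1))) (fun i => by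
    have := sub_pos.2 (hM i); positivity)
  have e1 : ∑ i, (1 - 2 * δ) * (1 / (M i - 1)) * (1 - 2 * δ)
      = (1 - 2 * δ) ^ 2 * ∑ i, 1 / (M i - 1) := by
    rw [mul_sum]; exact sum_congr rfl fun i _ => by ring
  have e2 : ∑ i, ((1 - 2 * δ) * (1 / (M i - 1))) ^ 2 * (M i - 1)
      = (1 - 2 * δ) ^ 2 * ∑ i, 1 / (M i - 1) := by
    rw [mul_sum]
    refine sum_congr rfl fun i _ => ?_
    have := (sub_pos.2 (hM i)).ne'
    field_simp
  rw [e1, e2] at h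
  linarith

open Finset in
/-- The sum of inverse `χ²` divergences is smallest for uniform sampling. -/
theorem card_div_le_sum_inv {τ ι : Type*} [Fintype τ] [Fintype ι] [Nonempty ι]
    (u : τ → ι → ℝ) (hu : ∀ t i, 0 ≤ u t i) (hu1 : ∀ t, ∑ i, u t i = 1) {c : ℝ} (hc : 0 < c)
    (hM : ∀ i, 1 < ∏ t, (1 + u t i * c)) :
    (Fintype.card ι : ℝ) / ((1 + c / Fintype.card ι) ^ Fintype.card τ - 1)
      ≤ ∑ i, 1 / (∏ t, (1 + u t i * c) - 1) := by
  have hn0 : (0 : ℝ) < Fintype.card ι := by exact_mod_cast Fintype.card_pos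
  have hτ : Fintype.card τ ≠ 0 := by
    intro h
    have := Fintype.card_eq_zero_iff.1 h
    simpa using hM (Classical.arbitrary ι)
  set G := (1 + c / Fintype.card ι) ^ Fintype.card τ with hGdef
  have hG : 1 < G := one_lt_pow₀ (by linarith [div_pos hc hn0]) hτ
  have hlog : ∑ i, Real.log ((∏ t, (1 + u t i * c)) / G) ≤ 0 := by
    have hpos : ∀ t i, 0 < 1 + u t i * c := fun t i => by
      have := mul_nonneg (hu t i) hc.le; linarith
    have : ∀ i, Real.log ((∏ t, (1 + u t i * c)) / G)
        = ∑ t, Real.log (1 + u t i * c) - Real.log G := fun i => by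
      rw [Real.log_div (prod_pos fun t _ => hpos t i).ne' (by linarith),
        Real.log_prod fun t _ => (hpos t i).ne']
    simp only [this, sum_sub_distrib]
    rw [sum_comm]
    have h := sum_le_sum fun t (_ : t ∈ univ) => sum_log_one_add_mul_le (u t) (hu t) (hu1 t) hc.le
    rw [hGdef, Real.log_pow]
    simp only [sum_const, card_univ, nsmul_eq_mul] at h ⊢
    linarith
  have h := sum_le_sum fun i (_ : i ∈ univ) => tangent_le_inv_sub_one (hM i) hG
  rw [sum_sub_distrib, ← mul_sum] at h
  simp only [sum_const, card_univ, nsmul_eq_mul, mul_one_div] at h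
  have h2 : G / (G - 1) ^ 2 * ∑ i, Real.log ((∏ t, (1 + u t i * c)) / G) ≤ 0 :=
    mul_nonpos_of_nonneg_of_nonpos (by positivity) hlog
  linarith


/-- Query-complexity lower bound for non-adaptively computing the OR of `K` noisy
bits: if a (possibly randomized, via a seed `ω` for the output rule) non-adaptive
`T`-round algorithm has worst-case error probability at most `δ < 1/2`, then
`T ≥ ln(1 + 2K(1-2δ)²)/ln(1 + (1-2p)²/(K(1-p)p))`. -/
theorem or_nonadaptive_query_lower_bound
    (K T : ℕ) (hK : 1 ≤ K) (p : ℝ) (hp0 : 0 < p) (hp1 : p < 1 / 2)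
    (δ : ℝ) (hδ0 : 0 < δ) (hδ1 : δ < 1 / 2)
    (π : Fin T → Fin K → ℝ) (hπ0 : ∀ t k, 0 ≤ π t k) (hπ1 : ∀ t, ∑ k, π t k = 1)
    (Ω : Type) [Fintype Ω] (w : Ω → ℝ) (hw0 : ∀ ω, 0 ≤ w ω) (hw1 : ∑ ω, w ω = 1)
    (out : Ω → (Fin T → Fin K) → (Fin T → Bool) → Bool)
    (herr : ∀ θ : Fin K → Bool, ∑ ω, w ω * naErrOR K T p π (out ω) θ ≤ δ) :
    Real.log (1 + 2 * (K : ℝ) * (1 - 2 * δ) ^ 2) /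
        Real.log (1 + (1 - 2 * p) ^ 2 / ((K : ℝ) * (1 - p) * p)) ≤ (T : ℝ) := by
  classical
  have hp1' : p < 1 := by linarith
  have hq : 0 < 1 - p := by linarith
  have : Nonempty (Fin K) := ⟨⟨0, hK⟩⟩
  set c : ℝ := (1 - 2 * p) ^ 2 / ((1 - p) * p) with hc
  have hc0 : 0 < c := by
    have : 0 < 1 - 2 * p := by linarith
    positivity
  let X := (Fin T → Fin K) × (Fin T → Bool)
  let P : X → ℝ := fun x => ∏ t, π t (x.1 t) * (if x.2 t = false then 1 - p else p)
  let l : Fin K → X → ℝ := fun j x => ∏ t, singleBitRatio p j (x.1 t) (x.2 t)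
  let φ : X → ℝ := fun x => ∑ ω, w ω * (if out ω x.1 x.2 = true then 1 else 0)
  let e : Fin K → Fin K → Bool := fun j k => decide (k = j)
  have hP : ∀ x, 0 ≤ P x := fun x =>
    Finset.prod_nonneg fun t _ => mul_nonneg (hπ0 _ _) (by split_ifs <;> linarith)
  have hsum : ∀ F : Fin T → Fin K → Bool → ℝ,
      ∑ x : X, ∏ t, π t (x.1 t) * F t (x.1 t) (x.2 t)
        = ∏ t, ∑ k, π t k * ∑ y, F t k y := by
    intro F
    rw [Fintype.sum_prod_type]
    simp only [Finset.mul_sum]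
    exact sum_sum_prod_eq_prod_sum_sum_s2 fun t k y => π t k * F t k y
  have hP1 : ∑ x, P x = 1 := by
    refine (hsum fun _ _ y => if y = false then 1 - p else p).trans ?_
    simp [hπ1]
  have hl : ∀ i, ∑ x, P x * l i x = 1 := by
    intro i
    have := hsum fun _ k y => (if y = false then 1 - p else p) * singleBitRatio p i k y
    simp only [sum_bool_mul_singleBitRatio hp0 hp1', mul_one, hπ1, Finset.prod_const_one] at this
    rw [← this]
    refine Finset.sum_congr rfl fun x _ => ?_
    simp only [P, l, ← Finset.prod_mul_distrib, mul_assoc]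
  have hll : ∀ i j, ∑ x, P x * (l i x * l j x)
      = if i = j then ∏ t, (1 + π t i * c) else 1 := by
    intro i j
    have := hsum fun _ k y => (if y = false then 1 - p else p) *
      (singleBitRatio p i k y * singleBitRatio p j k y)
    simp only [sum_bool_mul_singleBitRatio_mul hp0 hp1', ← hc] at this
    have h2 : ∑ x, P x * (l i x * l j x) = ∏ t, ∑ k, π t k *
        (1 + if k = i ∧ k = j then c else 0) := by
      rw [← this]
      refine Finset.sum_congr rfl fun x _ => ?_
      simp only [P, l, ← Finset.prod_mul_distrib, mul_assoc]
    rw [h2]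
    simp only [mul_add, mul_one, Finset.sum_add_distrib, hπ1]
    split_ifs with hij
    · subst hij; simp
    · refine Finset.prod_eq_one fun t _ => ?_
      rw [Finset.sum_eq_zero, add_zero]
      intro k _
      rw [if_neg, mul_zero]
      rintro ⟨rfl, h⟩
      exact hij h
  have hφ0 : ∀ x, 0 ≤ φ x := fun x =>
    Finset.sum_nonneg fun ω _ => mul_nonneg (hw0 ω) (by split_ifs <;> norm_num)
  have hφ1 : ∀ x, φ x ≤ 1 := fun x => by
    rw [← hw1]
    refine Finset.sum_le_sum fun ω _ => ?_
    have := hw0 ω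
    split_ifs <;> simp [this]
  have hswap : ∀ θ, ∑ ω, w ω * naErrOR K T p π (out ω) θ
      = ∑ x : X, (∏ t, π t (x.1 t) * (if x.2 t = θ (x.1 t) then 1 - p else p)) *
        ∑ ω, w ω * (if out ω x.1 x.2 = orFun θ then 0 else 1) := by
    intro θ
    have hX : ∀ ω, naErrOR K T p π (out ω) θ
        = ∑ x : X, (∏ t, π t (x.1 t) * (if x.2 t = θ (x.1 t) then 1 - p else p)) *
          (if out ω x.1 x.2 = orFun θ then 0 else 1) := fun ω => by
      rw [naErrOR, Fintype.sum_prod_type]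
    simp only [hX, Finset.mul_sum]
    rw [Finset.sum_comm]
    exact Finset.sum_congr rfl fun x _ => Finset.sum_congr rfl fun ω _ => by ring
  have h0 : ∑ x, P x * φ x ≤ δ := by
    refine le_trans (le_of_eq ?_) (herr fun _ => false)
    rw [hswap]
    refine Finset.sum_congr rfl fun x _ => ?_
    congr 1
    refine Finset.sum_congr rfl fun ω _ => ?_
    cases h : out ω x.1 x.2 <;> simp [orFun]
  have h1 : ∀ i, 1 - δ ≤ ∑ x, P x * l i x * φ x := by
    intro i
    have hor : orFun (e i) = true := by simp [orFun, e]
    have h := herr (e i)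
    rw [hswap, hor] at h
    have : ∑ x : X, (∏ t, π t (x.1 t) * (if x.2 t = e i (x.1 t) then 1 - p else p)) *
        ∑ ω, w ω * (if out ω x.1 x.2 = true then 0 else 1)
        = ∑ x, P x * l i x - ∑ x, P x * l i x * φ x := by
      rw [← Finset.sum_sub_distrib]
      refine Finset.sum_congr rfl fun x _ => ?_
      have e1 : ∑ ω, w ω * (if out ω x.1 x.2 = true then (0 : ℝ) else 1) = 1 - φ x := by
        refine Eq.trans ?_ (congrArg (· - φ x) hw1)
        simp only [φ, ← Finset.sum_sub_distrib]
        refine Finset.sum_congr rfl fun ω _ => ?_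
        split_ifs <;> ring
      have e2 : ∏ t, π t (x.1 t) * (if x.2 t = e i (x.1 t) then 1 - p else p)
          = P x * l i x := by
        simp only [P, l, ← Finset.prod_mul_distrib]
        refine Finset.prod_congr rfl fun t _ => ?_
        rw [mul_assoc]
        congr 1
        have := hp0.ne'
        have := hq.ne'
        by_cases hk : x.1 t = i <;> cases hy : x.2 t <;> simp [e, singleBitRatio, hk] <;>
          field_simp
      rw [e1, e2]; ring
    rw [this, hl] at h
    linarith
  obtain ⟨hM, hle⟩ := sum_inv_chiSq_le_of_test P hP hP1 l (fun i => ∏ t, (1 + π t i * c))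
    hl hll φ hφ0 hφ1 hδ0 hδ1 h0 h1
  have hge := card_div_le_sum_inv π hπ0 hπ1 hc0 hM
  simp only [Fintype.card_fin] at hge
  have hK0 : (0 : ℝ) < K := by exact_mod_cast hK
  have hcK : (1 - 2 * p) ^ 2 / ((K : ℝ) * (1 - p) * p) = c / K := by
    rw [hc, div_div]; congr 1; ring
  have hbase : 1 < 1 + c / K := by linarith [div_pos hc0 hK0]
  have hT : T ≠ 0 := by
    rintro rfl
    simpa using hM ⟨0, hK⟩
  have hG : 1 < (1 + c / K) ^ T := one_lt_pow₀ hbase hT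
  rw [hcK, div_le_iff₀ (Real.log_pos hbase), ← Real.log_pow]
  refine Real.log_le_log (by positivity) ?_
  have h2 := (mul_le_mul_of_nonneg_left hge (sq_nonneg (1 - 2 * δ))).trans hle
  rw [← mul_div_assoc, div_le_iff₀ (by linarith)] at h2
  nlinarith
end

section
/- For every K ≥ 1, p ∈ (0,1/2) and T ≥ 0, any non-adaptive T-round algorithm for the noisy search problem satisfies sup over instances X of P(μ̂ ≠ SEARCH(X)) ≥ (1/4)·exp(−T·D_KL(p‖1−p)/K). Consequently, any such algorithm whose worst-case error probability is at most δ < 1/4 must use T ≥ K·ln(1/(4δ))/D_KL(p‖1−p) queries. -/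
open Classical in
/-- `SEARCH(x)` for sorted values `Xs 0 < Xs 1 < ⋯ < Xs (K-1)`: the number of values
below the target `x`, i.e. the index `i ∈ {0,…,K}` with `X_i < x < X_{i+1}`
(where `X_0 = -∞`, `X_{K+1} = +∞`). -/
noncomputable def searchIdx {K : ℕ} (Xs : Fin K → ℝ) (x : ℝ) : ℕ :=
  (Finset.univ.filter fun i : Fin K => Xs i < x).card

/-- Error probability of a non-adaptive `T`-round strategy for the noisy search
problem with known sorted values `Xs` and target `x`.  The strategy fixes in advance
a sequence of distributions `π t` over indices; at round `t` an index `ks t` is drawn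
from `π t` independently of everything else, and the indicator of `x > Xs (ks t)`
flipped independently with probability `p` is observed.  The output rule `out` sees
the queried indices and the observations, and the algorithm errs unless its output
equals `SEARCH(x)`. -/
noncomputable def naErrSEARCH (K T : ℕ) (p : ℝ)
    (π : Fin T → Fin K → ℝ)
    (out : (Fin T → Fin K) → (Fin T → Bool) → ℕ) (Xs : Fin K → ℝ) (x : ℝ) : ℝ :=
  ∑ ks : Fin T → Fin K, ∑ ys : Fin T → Bool,
    (∏ t : Fin T, π t (ks t) * (if ys t = decide (x > Xs (ks t)) then 1 - p else p)) *
      (if out ks ys = searchIdx Xs x then 0 else 1)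

/-- Probability of the answer `y` to a query whose noiseless answer is `d`. -/
noncomputable def flipLik (p : ℝ) (d y : Bool) : ℝ := if y = d then 1 - p else p

/-- Joint probability of the queries `z.1` and the answers `z.2` when the noiseless answer to a
query of index `k` is `d k`. -/
noncomputable def transcriptProb {K T : ℕ} (p : ℝ) (π : Fin T → Fin K → ℝ) (d : Fin K → Bool)
    (z : (Fin T → Fin K) × (Fin T → Bool)) : ℝ :=
  ∏ t, π t (z.1 t) * flipLik p (d (z.1 t)) (z.2 t)

theorem sum_pair_prod_eq_prod_sum {K T : ℕ} (F : Fin T → Fin K → Bool → ℝ) :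
    ∑ z : (Fin T → Fin K) × (Fin T → Bool), ∏ t, F t (z.1 t) (z.2 t) = ∏ t, ∑ k, ∑ y, F t k y := by
  rw [Fintype.sum_prod_type, Finset.prod_univ_sum, Fintype.piFinset_univ]
  refine Finset.sum_congr rfl fun ks _ => ?_
  rw [Finset.prod_univ_sum, Fintype.piFinset_univ]

theorem flipLik_pos {p : ℝ} (hp0 : 0 < p) (hp1 : p < 1 / 2) (d y : Bool) : 0 < flipLik p d y := by
  unfold flipLik
  split_ifs <;> linarith

theorem sum_flipLik (p : ℝ) (d : Bool) : ∑ y, flipLik p d y = 1 := by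
  cases d <;> simp [flipLik]

theorem transcriptProb_nonneg {K T : ℕ} {p : ℝ} (hp0 : 0 < p) (hp1 : p < 1 / 2)
    {π : Fin T → Fin K → ℝ} (hπ0 : ∀ t k, 0 ≤ π t k) (d : Fin K → Bool)
    (z : (Fin T → Fin K) × (Fin T → Bool)) : 0 ≤ transcriptProb p π d z :=
  Finset.prod_nonneg fun t _ => mul_nonneg (hπ0 t _) (flipLik_pos hp0 hp1 _ _).le

theorem sum_transcriptProb {K T : ℕ} (p : ℝ) {π : Fin T → Fin K → ℝ}
    (hπ1 : ∀ t, ∑ k, π t k = 1) (d : Fin K → Bool) : ∑ z, transcriptProb p π d z = 1 := by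
  unfold transcriptProb
  rw [sum_pair_prod_eq_prod_sum fun t k y => π t k * flipLik p (d k) y]
  simp_rw [← Finset.mul_sum, sum_flipLik, mul_one, hπ1, Finset.prod_const_one]

theorem naErrSEARCH_eq_sum {K T : ℕ} (p : ℝ) (π : Fin T → Fin K → ℝ)
    (out : (Fin T → Fin K) → (Fin T → Bool) → ℕ) (Xs : Fin K → ℝ) (x : ℝ) :
    naErrSEARCH K T p π out Xs x =
      ∑ z, transcriptProb p π (fun k => decide (x > Xs k)) z *
        (if out z.1 z.2 = searchIdx Xs x then 0 else 1) := by
  rw [Fintype.sum_prod_type]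
  rfl

theorem naErrSEARCH_le_one {K T : ℕ} {p : ℝ} (hp0 : 0 < p) (hp1 : p < 1 / 2)
    {π : Fin T → Fin K → ℝ} (hπ0 : ∀ t k, 0 ≤ π t k) (hπ1 : ∀ t, ∑ k, π t k = 1)
    (out : (Fin T → Fin K) → (Fin T → Bool) → ℕ) (Xs : Fin K → ℝ) (x : ℝ) :
    naErrSEARCH K T p π out Xs x ≤ 1 := by
  rw [naErrSEARCH_eq_sum]
  refine (Finset.sum_le_sum fun z _ => mul_le_of_le_one_right
    (transcriptProb_nonneg hp0 hp1 hπ0 _ z) ?_).trans_eq (sum_transcriptProb p hπ1 _)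
  split_ifs <;> norm_num

/-- **Le Cam's two-point bound**, in the Bhattacharyya form: no test separates two distributions
whose densities have geometric mean `g` with total error below `(∑ g)² / 2`. -/
theorem sq_sum_le_two_mul_sum_min {ι : Type*} [Fintype ι] {P Q g : ι → ℝ}
    (hP : ∀ z, 0 ≤ P z) (hQ : ∀ z, 0 ≤ Q z) (hP1 : ∑ z, P z = 1) (hQ1 : ∑ z, Q z = 1)
    (hg : ∀ z, g z ^ 2 = P z * Q z) : (∑ z, g z) ^ 2 ≤ 2 * ∑ z, min (P z) (Q z) := by
  have hcs := Finset.sum_sq_le_sum_mul_sum_of_sq_le_mul Finset.univ (r := g)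
    (f := fun z => max (P z) (Q z)) (g := fun z => min (P z) (Q z))
    (fun z _ => le_max_of_le_left (hP z)) (fun z _ => le_min (hP z) (hQ z))
    (fun z _ => by rw [hg, max_mul_min])
  have hmax : ∑ z, max (P z) (Q z) ≤ 2 := by
    calc ∑ z, max (P z) (Q z) ≤ ∑ z, (P z + Q z) :=
          Finset.sum_le_sum fun z _ => max_le_add_of_nonneg (hP z) (hQ z)
      _ = 2 := by rw [Finset.sum_add_distrib, hP1, hQ1]; norm_num
  exact hcs.trans (mul_le_mul_of_nonneg_right hmax
    (Finset.sum_nonneg fun z _ => le_min (hP z) (hQ z)))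

theorem sum_min_le_naErrSEARCH_add {K T : ℕ} {p : ℝ} (hp0 : 0 < p) (hp1 : p < 1 / 2)
    {π : Fin T → Fin K → ℝ} (hπ0 : ∀ t k, 0 ≤ π t k)
    (out : (Fin T → Fin K) → (Fin T → Bool) → ℕ) (Xs : Fin K → ℝ) {x x' : ℝ}
    (hne : searchIdx Xs x ≠ searchIdx Xs x') :
    ∑ z, min (transcriptProb p π (fun k => decide (x > Xs k)) z)
        (transcriptProb p π (fun k => decide (x' > Xs k)) z) ≤
      naErrSEARCH K T p π out Xs x + naErrSEARCH K T p π out Xs x' := by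
  rw [naErrSEARCH_eq_sum, naErrSEARCH_eq_sum, ← Finset.sum_add_distrib]
  refine Finset.sum_le_sum fun z _ => ?_
  have h := transcriptProb_nonneg hp0 hp1 hπ0 (fun k => decide (x > Xs k)) z
  have h' := transcriptProb_nonneg hp0 hp1 hπ0 (fun k => decide (x' > Xs k)) z
  by_cases hx : out z.1 z.2 = searchIdx Xs x
  · rw [if_pos hx, if_neg fun hx' => hne (hx.symm.trans hx'), mul_zero, mul_one, zero_add]
    exact min_le_right _ _
  · rw [if_neg hx, mul_one]
    refine (min_le_left _ _).trans (le_add_of_nonneg_right (mul_nonneg h' ?_))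
    split_ifs <;> norm_num

theorem exp_neg_half_klBer_le {p : ℝ} (hp0 : 0 < p) (hp1 : p < 1 / 2) :
    Real.exp (-(klBer p / 2)) ≤ 2 * √((1 - p) * p) := by
  have hq : 0 < 1 - p := by linarith
  set L := Real.log ((1 - p) / p) with hL
  have hlog : L = Real.log (1 - p) - Real.log p := Real.log_div hq.ne' hp0.ne'
  have hconv := convexOn_exp.2 (Set.mem_univ (-(L / 2))) (Set.mem_univ (L / 2)) hq.le hp0.le
    (by ring)
  have hsqrt : √((1 - p) * p) = Real.exp ((Real.log (1 - p) + Real.log p) / 2) := by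
    rw [Real.exp_half, Real.exp_add, Real.exp_log hq, Real.exp_log hp0]
  have h1 : (1 - p) * Real.exp (-(L / 2)) = √((1 - p) * p) := by
    nth_rewrite 1 [← Real.exp_log hq]
    rw [← Real.exp_add, hsqrt, hlog]
    ring_nf
  have h2 : p * Real.exp (L / 2) = √((1 - p) * p) := by
    nth_rewrite 1 [← Real.exp_log hp0]
    rw [← Real.exp_add, hsqrt, hlog]
    ring_nf
  simp only [smul_eq_mul, h1, h2] at hconv
  rw [klBer, ← hL]
  calc Real.exp (-((1 - 2 * p) * L / 2))
      = Real.exp ((1 - p) * -(L / 2) + p * (L / 2)) := by ring_nf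
    _ ≤ _ := hconv.trans_eq (by ring)

theorem exp_neg_mul_le_one_sub_add {a c D : ℝ} (ha0 : 0 ≤ a) (ha1 : a ≤ 1)
    (hc : Real.exp (-D) ≤ c) : Real.exp (-(a * D)) ≤ 1 - a + a * c := by
  have hconv := convexOn_exp.2 (Set.mem_univ 0) (Set.mem_univ (-D)) (sub_nonneg.2 ha1) ha0
    (by ring)
  simp only [smul_eq_mul, mul_zero, zero_add, Real.exp_zero, mul_one, mul_neg] at hconv
  exact hconv.trans (by gcongr)

theorem sum_sqrt_flipLik_self {p : ℝ} (hp0 : 0 < p) (hp1 : p < 1 / 2) (d : Bool) :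
    ∑ y, √(flipLik p d y * flipLik p d y) = 1 := by
  simp_rw [Real.sqrt_mul_self (flipLik_pos hp0 hp1 d _).le]
  exact sum_flipLik p d

theorem sum_sqrt_flipLik_of_ne (p : ℝ) {d d' : Bool} (h : d ≠ d') :
    ∑ y, √(flipLik p d y * flipLik p d' y) = 2 * √((1 - p) * p) := by
  cases d <;> cases d' <;> simp_all [flipLik, mul_comm p, two_mul]

/-- Two noiseless answer patterns differing only at the index `i` have Bhattacharyya coefficient
at least `exp (-klBer p * N / 2)`, where `N` is the expected number of queries of `i`. -/
theorem exp_le_sum_bhattacharyya {K T : ℕ} {p : ℝ} (hp0 : 0 < p) (hp1 : p < 1 / 2)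
    {π : Fin T → Fin K → ℝ} (hπ0 : ∀ t k, 0 ≤ π t k) (hπ1 : ∀ t, ∑ k, π t k = 1)
    {d d' : Fin K → Bool} {i : Fin K} (hi : d i ≠ d' i) (hd : ∀ k, k ≠ i → d k = d' k) :
    Real.exp (-((∑ t, π t i) * (klBer p / 2))) ≤
      ∑ z : (Fin T → Fin K) × (Fin T → Bool),
        ∏ t, π t (z.1 t) * √(flipLik p (d (z.1 t)) (z.2 t) * flipLik p (d' (z.1 t)) (z.2 t)) := by
  rw [sum_pair_prod_eq_prod_sum fun t k y => π t k * √(flipLik p (d k) y * flipLik p (d' k) y),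
    Finset.sum_mul, ← Finset.sum_neg_distrib, Real.exp_sum]
  refine Finset.prod_le_prod (fun t _ => (Real.exp_pos _).le) fun t _ => ?_
  have hle : π t i ≤ 1 := hπ1 t ▸ Finset.single_le_sum (fun k _ => hπ0 t k) (Finset.mem_univ i)
  refine (exp_neg_mul_le_one_sub_add (hπ0 t i) hle (exp_neg_half_klBer_le hp0 hp1)).trans_eq ?_
  simp_rw [← Finset.mul_sum]
  have hrest : ∀ k ∈ Finset.univ.erase i,
      π t k * ∑ y, √(flipLik p (d k) y * flipLik p (d' k) y) = π t k := fun k hk => by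
    rw [hd k (Finset.ne_of_mem_erase hk), sum_sqrt_flipLik_self hp0 hp1, mul_one]
  rw [← Finset.add_sum_erase _ _ (Finset.mem_univ i), Finset.sum_congr rfl hrest,
    sum_sqrt_flipLik_of_ne p hi, ← hπ1 t, ← Finset.add_sum_erase _ _ (Finset.mem_univ i)]
  ring

theorem exists_target_just_below {K : ℕ} (Xs : Fin K → ℝ) (i : Fin K) :
    ∃ x : ℝ, (∀ j, x ≠ Xs j) ∧ ∀ j, Xs j < x ↔ Xs j < Xs i := by
  have h : ∀ᶠ x in nhdsWithin (Xs i) (Set.Iio (Xs i)), ∀ j, x ≠ Xs j ∧ (Xs j < x ↔ Xs j < Xs i) := by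
    refine Filter.eventually_all.2 fun j => ?_
    rcases lt_or_ge (Xs j) (Xs i) with hj | hj
    · filter_upwards [mem_nhdsWithin_of_mem_nhds (Ioi_mem_nhds hj)] with x hx
      exact ⟨(Set.mem_Ioi.1 hx).ne', iff_of_true hx hj⟩
    · filter_upwards [self_mem_nhdsWithin] with x hx
      have hx : x < Xs j := (Set.mem_Iio.1 hx).trans_le hj
      exact ⟨hx.ne, iff_of_false hx.not_gt hj.not_gt⟩
  obtain ⟨x, hx⟩ := h.exists
  exact ⟨x, fun j => (hx j).1, fun j => (hx j).2⟩

theorem exists_target_just_above {K : ℕ} (Xs : Fin K → ℝ) (i : Fin K) :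
    ∃ x : ℝ, (∀ j, x ≠ Xs j) ∧ ∀ j, Xs j < x ↔ Xs j ≤ Xs i := by
  have h : ∀ᶠ x in nhdsWithin (Xs i) (Set.Ioi (Xs i)), ∀ j, x ≠ Xs j ∧ (Xs j < x ↔ Xs j ≤ Xs i) := by
    refine Filter.eventually_all.2 fun j => ?_
    rcases le_or_gt (Xs j) (Xs i) with hj | hj
    · filter_upwards [self_mem_nhdsWithin] with x hx
      have hx : Xs j < x := hj.trans_lt (Set.mem_Ioi.1 hx)
      exact ⟨hx.ne', iff_of_true hx hj⟩
    · filter_upwards [mem_nhdsWithin_of_mem_nhds (Iio_mem_nhds hj)] with x hx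
      have hx : x < Xs j := hx
      exact ⟨hx.ne, iff_of_false hx.not_gt hj.not_ge⟩
  obtain ⟨x, hx⟩ := h.exists
  exact ⟨x, fun j => (hx j).1, fun j => (hx j).2⟩

theorem searchIdx_lt_searchIdx {K : ℕ} {Xs : Fin K → ℝ} {x x' : ℝ} {i : Fin K}
    (hle : x ≤ x') (hx : ¬ Xs i < x) (hx' : Xs i < x') : searchIdx Xs x < searchIdx Xs x' := by
  classical
  refine Finset.card_lt_card ((Finset.ssubset_iff_of_subset fun j hj => ?_).2 ⟨i, ?_, ?_⟩)
  · simp only [Finset.mem_filter, Finset.mem_univ, true_and] at hj ⊢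
    exact hj.trans_le hle
  · simpa using hx'
  · simpa using hx

theorem exists_sum_le_div {K T : ℕ} (hK : 1 ≤ K) {π : Fin T → Fin K → ℝ}
    (hπ1 : ∀ t, ∑ k, π t k = 1) : ∃ i, ∑ t, π t i ≤ (T : ℝ) / K := by
  have : Nonempty (Fin K) := ⟨⟨0, hK⟩⟩
  have hK0 : (K : ℝ) ≠ 0 := by positivity
  obtain ⟨i, -, hi⟩ := Finset.exists_le_of_sum_le (s := (Finset.univ : Finset (Fin K)))
    (f := fun k => ∑ t, π t k) (g := fun _ => (T : ℝ) / K) Finset.univ_nonempty (by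
      rw [Finset.sum_comm]
      simp [hπ1, mul_div_cancel₀ _ hK0])
  exact ⟨i, hi⟩

theorem exists_target_error_ge
    {K T : ℕ} (hK : 1 ≤ K) {p : ℝ} (hp0 : 0 < p) (hp1 : p < 1 / 2)
    {Xs : Fin K → ℝ} (hXs : StrictMono Xs)
    {π : Fin T → Fin K → ℝ} (hπ0 : ∀ t k, 0 ≤ π t k) (hπ1 : ∀ t, ∑ k, π t k = 1)
    {Ω : Type*} [Fintype Ω] {w : Ω → ℝ} (hw0 : ∀ ω, 0 ≤ w ω) (hw1 : ∑ ω, w ω = 1)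
    (out : Ω → (Fin T → Fin K) → (Fin T → Bool) → ℕ) :
    ∃ x : ℝ, (∀ i, x ≠ Xs i) ∧ (1 / 4 : ℝ) * Real.exp (-((T : ℝ) * klBer p) / K) ≤
      ∑ ω, w ω * naErrSEARCH K T p π (out ω) Xs x := by
  obtain ⟨i, hi⟩ := exists_sum_le_div hK hπ1
  obtain ⟨x, hx, hxi⟩ := exists_target_just_below Xs i
  obtain ⟨x', hx', hxi'⟩ := exists_target_just_above Xs i
  have hix : ¬ Xs i < x := by simp [hxi]
  have hix' : Xs i < x' := by simp [hxi']
  have hne := (searchIdx_lt_searchIdx ((not_lt.1 hix).trans hix'.le) hix hix').ne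
  set P := transcriptProb p π fun k => decide (x > Xs k) with hP
  set Q := transcriptProb p π fun k => decide (x' > Xs k) with hQ
  have hbc := exp_le_sum_bhattacharyya hp0 hp1 hπ0 hπ1 (d := fun k => decide (x > Xs k))
    (d' := fun k => decide (x' > Xs k)) (i := i) (by simp [hix, hix']) fun k hk => by
      have : Xs k ≠ Xs i := hXs.injective.ne hk
      simp [hxi, hxi', le_iff_lt_or_eq, this]
  have hmin := sq_sum_le_two_mul_sum_min (P := P) (Q := Q)
    (g := fun z => ∏ t, π t (z.1 t) * √(flipLik p (decide (x > Xs (z.1 t))) (z.2 t) *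
      flipLik p (decide (x' > Xs (z.1 t))) (z.2 t)))
    (transcriptProb_nonneg hp0 hp1 hπ0 _) (transcriptProb_nonneg hp0 hp1 hπ0 _)
    (sum_transcriptProb p hπ1 _) (sum_transcriptProb p hπ1 _) fun z => by
      simp only [hP, hQ, transcriptProb]
      rw [← Finset.prod_pow, ← Finset.prod_mul_distrib]
      refine Finset.prod_congr rfl fun t _ => ?_
      rw [mul_pow, Real.sq_sqrt (mul_pos (flipLik_pos hp0 hp1 _ _) (flipLik_pos hp0 hp1 _ _)).le]
      ring
  have hexp : Real.exp (-((T : ℝ) * klBer p) / K) ≤ 2 * ∑ z, min (P z) (Q z) := by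
    refine le_trans ?_ ((pow_le_pow_left₀ (Real.exp_pos _).le hbc 2).trans hmin)
    rw [← Real.exp_nat_mul, Real.exp_le_exp]
    have := mul_le_mul_of_nonneg_right hi (klBer_pos hp0 hp1).le
    have heq : -((T : ℝ) * klBer p) / K = -((T : ℝ) / K * klBer p) := by ring
    rw [heq]
    push_cast
    linarith
  have hsum : ∑ z, min (P z) (Q z) ≤ ∑ ω, w ω * naErrSEARCH K T p π (out ω) Xs x +
      ∑ ω, w ω * naErrSEARCH K T p π (out ω) Xs x' := by
    rw [← Finset.sum_add_distrib, ← one_mul (∑ z, _), ← hw1, Finset.sum_mul]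
    refine Finset.sum_le_sum fun ω _ => ?_
    rw [← mul_add]
    exact mul_le_mul_of_nonneg_left (sum_min_le_naErrSEARCH_add hp0 hp1 hπ0 _ Xs hne) (hw0 ω)
  by_contra! hcon
  have h := hcon x hx
  have h' := hcon x' hx'
  linarith

/-- Lower bound for the non-adaptive noisy search problem.  For any known sorted
values `Xs`, any (possibly randomized, via a seed `ω` for the output rule)
non-adaptive `T`-round algorithm has worst-case error probability, over targets `x`
distinct from all `Xs i`, at least `(1/4)·exp(-T·D_KL(p‖1-p)/K)`; consequently, if
its worst-case error probability is at most `δ < 1/4` then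
`T ≥ K·ln(1/(4δ))/D_KL(p‖1-p)`. -/
theorem search_nonadaptive_lower_bound
    (K T : ℕ) (hK : 1 ≤ K) (p : ℝ) (hp0 : 0 < p) (hp1 : p < 1 / 2)
    (Xs : Fin K → ℝ) (hXs : StrictMono Xs)
    (π : Fin T → Fin K → ℝ) (hπ0 : ∀ t k, 0 ≤ π t k) (hπ1 : ∀ t, ∑ k, π t k = 1)
    (Ω : Type) [Fintype Ω] (w : Ω → ℝ) (hw0 : ∀ ω, 0 ≤ w ω) (hw1 : ∑ ω, w ω = 1)
    (out : Ω → (Fin T → Fin K) → (Fin T → Bool) → ℕ) :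
    (1 / 4 : ℝ) * Real.exp (-((T : ℝ) * klBer p) / K) ≤
        (⨆ x : {x : ℝ // ∀ i, x ≠ Xs i},
          ∑ ω, w ω * naErrSEARCH K T p π (out ω) Xs x.1) ∧
      ∀ δ : ℝ, 0 < δ → δ < 1 / 4 →
        (∀ x : ℝ, (∀ i, x ≠ Xs i) →
          ∑ ω, w ω * naErrSEARCH K T p π (out ω) Xs x ≤ δ) →
        (K : ℝ) * Real.log (1 / (4 * δ)) / klBer p ≤ (T : ℝ) := by
  obtain ⟨x₀, hx₀, herr⟩ := exists_target_error_ge hK hp0 hp1 hXs hπ0 hπ1 hw0 hw1 out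
  refine ⟨?_, fun δ hδ _ hle => ?_⟩
  · refine herr.trans (le_ciSup (f := fun x : {x : ℝ // ∀ i, x ≠ Xs i} =>
      ∑ ω, w ω * naErrSEARCH K T p π (out ω) Xs x.1) ⟨1, ?_⟩ ⟨x₀, hx₀⟩)
    rintro _ ⟨x, rfl⟩
    rw [← hw1]
    exact Finset.sum_le_sum fun ω _ =>
      mul_le_of_le_one_right (hw0 ω) (naErrSEARCH_le_one hp0 hp1 hπ0 hπ1 _ _ _)
  · have hK0 : (0 : ℝ) < K := by exact_mod_cast hK
    have hexp := herr.trans (hle x₀ hx₀)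
    have hlog : -((T : ℝ) * klBer p) / K ≤ Real.log (4 * δ) := by
      rw [Real.le_log_iff_exp_le (by positivity)]
      linarith
    rw [div_le_iff₀ (klBer_pos hp0 hp1), one_div, Real.log_inv]
    rw [div_le_iff₀ hK0] at hlog
    linarith
end

section
/- There exists a universal constant C > 0 such that for all K ≥ 2, p ∈ (0,1/2) and δ ∈ (0,1/2), there are non-adaptive query algorithms whose error probability is at most δ on every instance and whose number of queries is at most: C·K·ln(K/δ)/(1−H(p)) for computing OR of K noisy bits; C·K²·ln(K/δ)/(1−H(p)) for computing MAX of K items from noisy pairwise comparisons; C·K·ln(1/δ)/(1−H(p)) for the noisy SEARCH problem on K sorted values; and C·K²·ln(K/δ)/(1−H(p)) for sorting K items from noisy pairwise comparisons. -/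
/-- Binary entropy (in bits): `H(p) = -p log₂ p - (1-p) log₂ (1-p)`. -/
noncomputable def binEnt (p : ℝ) : ℝ :=
  -(p * Real.logb 2 p) - (1 - p) * Real.logb 2 (1 - p)

/-- Error probability of a non-adaptive strategy with a fixed (in advance) sequence of
queried indices `ks` for computing the OR of `K` noisy bits with true bits `θ`. -/
noncomputable def fixErrOR (K T : ℕ) (p : ℝ) (ks : Fin T → Fin K)
    (out : (Fin T → Bool) → Bool) (θ : Fin K → Bool) : ℝ :=
  ∑ ys : Fin T → Bool,
    (∏ t : Fin T, if ys t = θ (ks t) then 1 - p else p) *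
      (if out ys = orFun θ then 0 else 1)

open Classical in
/-- Error probability of a non-adaptive strategy with a fixed sequence of queried
pairs `ks` for identifying the maximum of `K` items with values `θ` from noisy
pairwise comparisons. -/
noncomputable def fixErrMAX (K T : ℕ) (p : ℝ) (ks : Fin T → Fin K × Fin K)
    (out : (Fin T → Bool) → Fin K) (θ : Fin K → ℝ) : ℝ :=
  ∑ ys : Fin T → Bool,
    (∏ t : Fin T, if ys t = decide (θ (ks t).1 > θ (ks t).2) then 1 - p else p) *
      (if ∀ j, j ≠ out ys → θ j < θ (out ys) then 0 else 1)

/-- Error probability of a non-adaptive strategy with a fixed sequence of queried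
indices `ks` for the noisy search problem with sorted values `Xs` and target `x`. -/
noncomputable def fixErrSEARCH (K T : ℕ) (p : ℝ) (ks : Fin T → Fin K)
    (out : (Fin T → Bool) → ℕ) (Xs : Fin K → ℝ) (x : ℝ) : ℝ :=
  ∑ ys : Fin T → Bool,
    (∏ t : Fin T, if ys t = decide (x > Xs (ks t)) then 1 - p else p) *
      (if out ys = searchIdx Xs x then 0 else 1)

open Classical in
/-- Error probability of a non-adaptive strategy with a fixed sequence of queried
pairs `ks` for sorting `K` items with values `θ` from noisy pairwise comparisons. -/
noncomputable def fixErrSORT (K T : ℕ) (p : ℝ) (ks : Fin T → Fin K × Fin K)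
    (out : (Fin T → Bool) → Equiv.Perm (Fin K)) (θ : Fin K → ℝ) : ℝ :=
  ∑ ys : Fin T → Bool,
    (∏ t : Fin T, if ys t = decide (θ (ks t).1 > θ (ks t).2) then 1 - p else p) *
      (if StrictMono (fun i => θ (out ys i)) then 0 else 1)

/-- Pairwise Bhattacharyya bound for decoding: replacing the true likelihood by the geometric mean
of two likelihoods factorizes over the queries. -/
theorem sum_sqrt_likelihood_mul {T : ℕ} {p : ℝ} (hp0 : 0 ≤ p) (hp1 : p ≤ 1) (a b : Fin T → Bool) :
    ∑ ys : Fin T → Bool,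
      √((∏ t, if ys t = a t then 1 - p else p) * ∏ t, if ys t = b t then 1 - p else p) =
      ∏ t, if b t = a t then 1 else 2 * √(p * (1 - p)) := by
  have hq : 0 ≤ 1 - p := by linarith
  have hnn : ∀ u v : Bool, 0 ≤ (if u = v then 1 - p else p) := by
    intro u v; split_ifs <;> assumption
  have key : ∀ t, (if b t = a t then 1 else 2 * √(p * (1 - p))) =
      ∑ y : Bool, √((if y = a t then 1 - p else p) * if y = b t then 1 - p else p) := by
    intro t
    rw [Fintype.sum_bool]
    cases a t <;> cases b t <;>
      simp [Real.sqrt_mul_self hp0, Real.sqrt_mul_self hq, mul_comm (1 - p) p, two_mul]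
  simp_rw [key]
  rw [Finset.prod_univ_sum, Fintype.piFinset_univ]
  refine Finset.sum_congr rfl fun ys _ => ?_
  rw [← Finset.prod_mul_distrib,
    Real.sqrt_eq_rpow, ← Real.finsetProd_rpow _ _ fun t _ => mul_nonneg (hnn _ _) (hnn _ _)]
  simp_rw [Real.sqrt_eq_rpow]

/-- Asking each question `m` times and decoding by maximum likelihood among the candidate answer
vectors `a`, the error probability obeys the union Bhattacharyya bound. -/
theorem exists_maxLikelihood_decoder {p : ℝ} (hp0 : 0 ≤ p) (hp1 : p ≤ 1) {Q ι : Type*} [Fintype Q]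
    [Fintype ι] [DecidableEq ι] [Nonempty ι] (a : ι → Q → Bool) (m : ℕ) :
    ∃ (ks : Fin (Fintype.card Q * m) → Q) (D : (Fin (Fintype.card Q * m) → Bool) → ι),
      ∀ h, ∑ ys : Fin (Fintype.card Q * m) → Bool,
        (∏ t, if ys t = a h (ks t) then 1 - p else p) * (if D ys = h then 0 else 1) ≤
        ∑ g ∈ Finset.univ.erase h,
          ∏ q, if a g q = a h q then 1 else (2 * √(p * (1 - p))) ^ m := by
  classical
  have hcard : Fintype.card (Q × Fin m) = Fintype.card Q * m := by simp
  let e : Q × Fin m ≃ Fin (Fintype.card Q * m) := Fintype.equivFinOfCardEq hcard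
  let ks : Fin (Fintype.card Q * m) → Q := fun t => (e.symm t).1
  let L : ι → (Fin (Fintype.card Q * m) → Bool) → ℝ :=
    fun h ys => ∏ t, if ys t = a h (ks t) then 1 - p else p
  have hL : ∀ h ys, 0 ≤ L h ys := fun h ys =>
    Finset.prod_nonneg fun t _ => by split_ifs <;> linarith
  choose D hD using fun ys => Finite.exists_max fun h => L h ys
  refine ⟨ks, D, fun h => ?_⟩
  have hprod : ∀ g, (∏ q, if a g q = a h q then 1 else (2 * √(p * (1 - p))) ^ m) =
      ∑ ys, √(L h ys * L g ys) := by
    intro g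
    rw [sum_sqrt_likelihood_mul hp0 hp1 (fun t => a h (ks t)) (fun t => a g (ks t)),
      ← e.prod_comp, Fintype.prod_prod_type]
    refine Finset.prod_congr rfl fun q _ => ?_
    simp only [ks, Equiv.symm_apply_apply, Finset.prod_const, Finset.card_univ, Fintype.card_fin]
    split_ifs <;> simp
  simp_rw [hprod]
  rw [Finset.sum_comm]
  refine Finset.sum_le_sum fun ys _ => ?_
  change L h ys * _ ≤ _
  split_ifs with hdec
  · rw [mul_zero]
    exact Finset.sum_nonneg fun _ _ => Real.sqrt_nonneg _
  · rw [mul_one]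
    calc L h ys ≤ √(L h ys * L (D ys) ys) :=
          Real.le_sqrt_of_sq_le (by rw [sq]; exact mul_le_mul_of_nonneg_left (hD ys h) (hL h ys))
      _ ≤ _ := Finset.single_le_sum (f := fun g => √(L h ys * L g ys))
          (fun _ _ => Real.sqrt_nonneg _) (Finset.mem_erase.2 ⟨hdec, Finset.mem_univ _⟩)

theorem one_sub_binEnt_eq {p : ℝ} :
    1 - binEnt p = (Real.log 2 - Real.binEntropy p) / Real.log 2 := by
  have h2 : Real.log 2 ≠ 0 := (Real.log_pos one_lt_two).ne'
  rw [binEnt, Real.binEntropy, Real.logb, Real.logb, Real.log_inv, Real.log_inv]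
  field_simp
  ring

theorem one_sub_binEnt_pos {p : ℝ} (hp : p < 1 / 2) : 0 < 1 - binEnt p := by
  rw [one_sub_binEnt_eq]
  refine div_pos (sub_pos.2 (Real.binEntropy_lt_log_two.2 ?_)) (Real.log_pos one_lt_two)
  norm_num at hp ⊢
  exact hp.ne

theorem one_sub_binEnt_le {p : ℝ} (hp0 : 0 < p) (hp : p < 1 / 2) :
    1 - binEnt p ≤ 2 * (1 - 2 * p) ^ 2 := by
  have h2 : 1 / 2 < Real.log 2 := by linarith [Real.log_two_gt_d9]
  rw [one_sub_binEnt_eq, div_le_iff₀ (by linarith), Real.binEntropy, Real.log_inv, Real.log_inv]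
  have h1 := Real.log_le_sub_one_of_pos (x := 2 * p) (by linarith)
  have h3 := Real.log_le_sub_one_of_pos (x := 2 * (1 - p)) (by linarith)
  rw [Real.log_mul (by norm_num) hp0.ne'] at h1
  rw [Real.log_mul (by norm_num) (by linarith)] at h3
  have h4 := mul_le_mul_of_nonneg_left h1 hp0.le
  have h5 := mul_le_mul_of_nonneg_left h3 (show 0 ≤ 1 - p by linarith)
  nlinarith [mul_le_mul_of_nonneg_left h2.le (sq_nonneg (1 - 2 * p))]

/-- Number of repetitions bringing the Bhattacharyya coefficient of a noisy bit below `ε`. -/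
theorem exists_repetitions {p ε : ℝ} (hp0 : 0 < p) (hp : p < 1 / 2) (hε0 : 0 < ε)
    (hε : ε ≤ 1 / 2) :
    ∃ m : ℕ, (2 * √(p * (1 - p))) ^ m ≤ ε ∧ (m : ℝ) ≤ 8 * Real.log (1 / ε) / (1 - binEnt p) := by
  set s := (1 - 2 * p) ^ 2 with hs
  have hs0 : 0 < s := pow_pos (by linarith) 2
  have hs1 : s ≤ 1 := by nlinarith
  have hL : 1 / 2 ≤ Real.log (1 / ε) := by
    have : Real.log 2 ≤ Real.log (1 / ε) :=
      Real.log_le_log (by norm_num) (by rw [le_div_iff₀ hε0]; linarith)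
    linarith [Real.log_two_gt_d9]
  refine ⟨⌈2 * Real.log (1 / ε) / s⌉₊, ?_, ?_⟩
  · set m := ⌈2 * Real.log (1 / ε) / s⌉₊
    have hm : 2 * Real.log (1 / ε) ≤ m * s := (div_le_iff₀ hs0).1 (Nat.le_ceil _)
    have hsq : (2 * √(p * (1 - p))) ^ 2 = 1 - s := by
      rw [mul_pow, Real.sq_sqrt (mul_nonneg hp0.le (by linarith)), hs]; ring
    refine (sq_le_sq₀ (by positivity) hε0.le).1 ?_
    calc ((2 * √(p * (1 - p))) ^ m) ^ 2 = (1 - s) ^ m := by rw [pow_right_comm, hsq]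
      _ ≤ Real.exp (-s) ^ m :=
          pow_le_pow_left₀ (by linarith) (by linarith [Real.add_one_le_exp (-s)]) m
      _ = Real.exp (-(m * s)) := by rw [← Real.exp_nat_mul]; ring_nf
      _ ≤ Real.exp (2 * Real.log ε) := by
          refine Real.exp_le_exp.2 ?_
          rw [one_div, Real.log_inv] at hm
          linarith
      _ = ε ^ 2 := by rw [two_mul, Real.exp_add, Real.exp_log hε0, sq]
  · have hH := one_sub_binEnt_pos hp
    calc (⌈2 * Real.log (1 / ε) / s⌉₊ : ℝ) ≤ 2 * Real.log (1 / ε) / s + 1 :=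
          (Nat.ceil_lt_add_one (by positivity)).le
      _ ≤ 4 * Real.log (1 / ε) / s := by
          rw [div_add_one hs0.ne']
          gcongr
          linarith
      _ ≤ 8 * Real.log (1 / ε) / (1 - binEnt p) := by
          rw [div_le_div_iff₀ hs0 hH]
          nlinarith [one_sub_binEnt_le hp0 hp]

/-- All answers to a finite set of yes/no questions can be recovered from noisy answers. -/
theorem exists_bits_decoder {p δ : ℝ} (hp0 : 0 < p) (hp : p < 1 / 2) (hδ0 : 0 < δ)
    (hδ : δ < 1 / 2) (Q : Type*) [Fintype Q] [Nonempty Q] [DecidableEq Q] :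
    ∃ (T : ℕ) (ks : Fin T → Q) (D : (Fin T → Bool) → Q → Bool),
      (T : ℝ) ≤ Fintype.card Q *
        (8 * Real.log (2 * Fintype.card Q / δ) / (1 - binEnt p)) ∧
      ∀ h : Q → Bool, ∑ ys : Fin T → Bool,
        (∏ t, if ys t = h (ks t) then 1 - p else p) * (if D ys = h then 0 else 1) ≤ δ := by
  have hN : (1 : ℝ) ≤ Fintype.card Q := by exact_mod_cast Fintype.card_pos
  obtain ⟨m, hm, hmT⟩ := exists_repetitions (ε := δ / (2 * Fintype.card Q)) hp0 hp (by positivity)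
    (by rw [div_le_iff₀ (by positivity)]; linarith)
  obtain ⟨ks, D, hD⟩ :=
    exists_maxLikelihood_decoder (p := p) hp0.le (by linarith) (fun h : Q → Bool => h) m
  refine ⟨_, ks, D, ?_, fun h => (hD h).trans ?_⟩
  · rw [one_div_div] at hmT
    push_cast
    gcongr
  · set r := (2 * √(p * (1 - p))) ^ m
    have hr : 0 ≤ r := by positivity
    have hsum : ∑ g : Q → Bool, ∏ q, (if g q = h q then 1 else r) = (1 + r) ^ Fintype.card Q := by
      have := Finset.prod_univ_sum (fun _ : Q => (Finset.univ : Finset Bool))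
        (fun q b => if b = h q then (1 : ℝ) else r)
      rw [Fintype.piFinset_univ] at this
      rw [← this, ← Finset.card_univ, ← Finset.prod_const]
      refine Finset.prod_congr rfl fun q _ => ?_
      rw [Fintype.sum_bool]
      cases h q <;> simp [add_comm]
    rw [← Finset.add_sum_erase _ _ (Finset.mem_univ h)] at hsum
    simp only [if_true, Finset.prod_const_one] at hsum
    have hexp : (1 + r) ^ Fintype.card Q ≤ 1 + δ :=
      calc (1 + r) ^ Fintype.card Q ≤ Real.exp r ^ Fintype.card Q :=
            pow_le_pow_left₀ (by positivity) (by linarith [Real.add_one_le_exp r]) _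
        _ = Real.exp (Fintype.card Q * r) := by rw [← Real.exp_nat_mul]
        _ ≤ Real.exp (δ / 2) := by
            refine Real.exp_le_exp.2 ?_
            rw [le_div_iff₀ (by positivity)] at hm
            linarith
        _ ≤ 1 + δ := by
            have h1 := Real.exp_bound_div_one_sub_of_interval (x := δ / 2) (by linarith)
              (by linarith)
            refine h1.trans ?_
            rw [div_le_iff₀ (by linarith)]
            nlinarith
    linarith

/-- A loss that vanishes whenever the decoder is correct has no larger expectation than the
decoding error. -/
theorem sum_mul_ite_le_of_imp {T : ℕ} {p : ℝ} (hp0 : 0 ≤ p) (hp1 : p ≤ 1) (b : Fin T → Bool)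
    (A B : (Fin T → Bool) → Prop) [DecidablePred A] [DecidablePred B] (hAB : ∀ ys, A ys → B ys) :
    ∑ ys : Fin T → Bool,
      (∏ t, if ys t = b t then 1 - p else p) * (if B ys then (0 : ℝ) else 1) ≤
    ∑ ys : Fin T → Bool,
      (∏ t, if ys t = b t then 1 - p else p) * (if A ys then (0 : ℝ) else 1) := by
  refine Finset.sum_le_sum fun ys _ => mul_le_mul_of_nonneg_left ?_
    (Finset.prod_nonneg fun t _ => by split_ifs <;> linarith)
  have := hAB ys
  split_ifs <;> simp_all

theorem lt_searchIdx_iff {K : ℕ} {Xs : Fin K → ℝ} (hXs : StrictMono Xs) (x : ℝ) (q : Fin K) :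
    (q : ℕ) < searchIdx Xs x ↔ Xs q < x := by
  classical
  rw [searchIdx]
  constructor
  · intro h
    by_contra! hq
    have hsub : (Finset.univ.filter fun i : Fin K => Xs i < x) ⊆ Finset.Iio q := by
      intro i hi
      rw [Finset.mem_filter] at hi
      exact Finset.mem_Iio.2 (hXs.lt_iff_lt.1 (hi.2.trans_le hq))
    have := Finset.card_le_card hsub
    rw [Fin.card_Iio] at this
    convert absurd h (not_lt.2 this)
  · intro hq
    have hsub : Finset.Iic q ⊆ (Finset.univ.filter fun i : Fin K => Xs i < x) := by
      intro i hi
      rw [Finset.mem_filter]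
      exact ⟨Finset.mem_univ _, (hXs.monotone (Finset.mem_Iic.1 hi)).trans_lt hq⟩
    have := Finset.card_le_card hsub
    rw [Fin.card_Iic] at this
    convert Nat.lt_of_succ_le this

theorem searchIdx_le {K : ℕ} (Xs : Fin K → ℝ) (x : ℝ) : searchIdx Xs x ≤ K := by
  classical
  exact (Finset.card_le_univ _).trans_eq (Fintype.card_fin K)

theorem sum_range_pow_dist_le {r : ℝ} (hr0 : 0 ≤ r) (hr : r ≤ 1 / 2) (h k : ℕ) :
    ∑ g ∈ Finset.range (h + (k + 1)), r ^ Nat.dist g h ≤ 1 + 2 * (r / (1 - r)) := by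
  have hgeom : ∀ n, ∑ i ∈ Finset.range n, r ^ (i + 1) ≤ r / (1 - r) := by
    intro n
    rw [le_div_iff₀ (by linarith)]
    simp_rw [pow_succ']
    rw [← Finset.mul_sum, mul_assoc, geom_sum_mul_neg]
    nlinarith [pow_nonneg hr0 n]
  rw [Finset.sum_range_add, Finset.sum_range_succ', ← Finset.sum_range_reflect]
  have h1 : ∑ j ∈ Finset.range h, r ^ Nat.dist (h - 1 - j) h =
      ∑ j ∈ Finset.range h, r ^ (j + 1) := by
    refine Finset.sum_congr rfl fun j hj => ?_
    rw [Finset.mem_range] at hj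
    congr 1
    rw [Nat.dist]
    omega
  have h2 : ∑ j ∈ Finset.range k, r ^ Nat.dist (h + (j + 1)) h =
      ∑ j ∈ Finset.range k, r ^ (j + 1) := by
    refine Finset.sum_congr rfl fun j _ => ?_
    congr 1
    rw [Nat.dist]
    omega
  rw [h1, h2, add_zero, Nat.dist_self, pow_zero]
  linarith [hgeom h, hgeom k]

theorem prod_ite_threshold {K g h : ℕ} (hg : g ≤ K) (hh : h ≤ K) (r : ℝ) :
    (∏ q : Fin K, if decide ((q : ℕ) < g) = decide ((q : ℕ) < h) then 1 else r) =
      r ^ Nat.dist g h := by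
  rw [Fin.prod_univ_eq_prod_range
    (fun q => if decide (q < g) = decide (q < h) then (1 : ℝ) else r) K,
    Finset.prod_ite, Finset.prod_const_one, one_mul, Finset.prod_const]
  congr 1
  have : (Finset.range K).filter (fun q => ¬decide (q < g) = decide (q < h)) =
      Finset.Ico (min g h) (max g h) := by
    ext q
    simp only [Finset.mem_filter, Finset.mem_range, Finset.mem_Ico, decide_eq_decide]
    omega
  rw [this, Nat.card_Ico, Nat.dist]
  omega

/-- The number of sorted values below the target is recovered without a `log K` factor. -/
theorem exists_threshold_decoder {p δ : ℝ} (hp0 : 0 < p) (hp : p < 1 / 2) (hδ0 : 0 < δ)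
    (hδ : δ < 1 / 2) (K : ℕ) :
    ∃ (T : ℕ) (ks : Fin T → Fin K) (D : (Fin T → Bool) → ℕ),
      (T : ℝ) ≤ K * (8 * Real.log (4 / δ) / (1 - binEnt p)) ∧
      ∀ h ≤ K, ∑ ys : Fin T → Bool,
        (∏ t, if ys t = decide ((ks t : ℕ) < h) then 1 - p else p) *
          (if D ys = h then 0 else 1) ≤ δ := by
  obtain ⟨m, hm, hmT⟩ := exists_repetitions (ε := δ / 4) hp0 hp (by positivity) (by linarith)
  obtain ⟨ks, D, hD⟩ := exists_maxLikelihood_decoder (p := p) hp0.le (by linarith)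
    (fun (h : Fin (K + 1)) (q : Fin K) => decide ((q : ℕ) < h)) m
  refine ⟨_, ks, fun ys => D ys, ?_, fun h hh => ?_⟩
  · rw [one_div_div] at hmT
    push_cast
    rw [Fintype.card_fin]
    gcongr
  · set r := (2 * √(p * (1 - p))) ^ m
    have hr : 0 ≤ r := by positivity
    let h' : Fin (K + 1) := ⟨h, by omega⟩
    refine (sum_mul_ite_le_of_imp hp0.le (by linarith) (fun t => decide ((ks t : ℕ) < h))
      (fun ys => D ys = h') (fun ys => (D ys : ℕ) = h) fun ys hys => by rw [hys]).trans
      ((hD h').trans ?_)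
    have hsum : ∑ g : Fin (K + 1), r ^ Nat.dist g h ≤ 1 + 2 * (r / (1 - r)) := by
      rw [Fin.sum_univ_eq_sum_range (fun g => r ^ Nat.dist g h)]
      obtain ⟨k, rfl⟩ := Nat.exists_eq_add_of_le hh
      exact sum_range_pow_dist_le hr (by linarith) h k
    rw [← Finset.add_sum_erase _ _ (Finset.mem_univ h'), Nat.dist_self, pow_zero] at hsum
    have hrδ : 2 * (r / (1 - r)) ≤ δ := by
      rw [← mul_div_assoc, div_le_iff₀ (by linarith)]
      nlinarith
    refine le_trans (le_of_eq (Finset.sum_congr rfl fun g _ => ?_))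
      ((add_le_add_iff_left 1).1 (hsum.trans ((add_le_add_iff_left 1).2 hrδ)))
    exact prod_ite_threshold (by omega) hh r

/-- Non-adaptive upper bounds: there is a universal constant `C > 0` such that for all
`K ≥ 2`, `p ∈ (0,1/2)` and `δ ∈ (0,1/2)` there are non-adaptive algorithms whose error
probability is at most `δ` on every instance using at most `C·K·ln(K/δ)/(1-H(p))`
queries for OR, `C·K²·ln(K/δ)/(1-H(p))` queries for MAX, `C·K·ln(1/δ)/(1-H(p))`
queries for SEARCH, and `C·K²·ln(K/δ)/(1-H(p))` queries for SORT. -/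
theorem nonadaptive_upper_bounds :
    ∃ C : ℝ, 0 < C ∧
      ∀ (K : ℕ), 2 ≤ K → ∀ p δ : ℝ, 0 < p → p < 1 / 2 → 0 < δ → δ < 1 / 2 →
        (∃ (T : ℕ) (ks : Fin T → Fin K) (out : (Fin T → Bool) → Bool),
          (T : ℝ) ≤ C * (K : ℝ) * Real.log ((K : ℝ) / δ) / (1 - binEnt p) ∧
          ∀ θ : Fin K → Bool, fixErrOR K T p ks out θ ≤ δ) ∧
        (∃ (T : ℕ) (ks : Fin T → Fin K × Fin K) (out : (Fin T → Bool) → Fin K),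
          (T : ℝ) ≤ C * (K : ℝ) ^ 2 * Real.log ((K : ℝ) / δ) / (1 - binEnt p) ∧
          ∀ θ : Fin K → ℝ, Function.Injective θ → fixErrMAX K T p ks out θ ≤ δ) ∧
        (∀ Xs : Fin K → ℝ, StrictMono Xs →
          ∃ (T : ℕ) (ks : Fin T → Fin K) (out : (Fin T → Bool) → ℕ),
            (T : ℝ) ≤ C * (K : ℝ) * Real.log (1 / δ) / (1 - binEnt p) ∧
            ∀ x : ℝ, (∀ i, x ≠ Xs i) → fixErrSEARCH K T p ks out Xs x ≤ δ) ∧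
        (∃ (T : ℕ) (ks : Fin T → Fin K × Fin K)
            (out : (Fin T → Bool) → Equiv.Perm (Fin K)),
          (T : ℝ) ≤ C * (K : ℝ) ^ 2 * Real.log ((K : ℝ) / δ) / (1 - binEnt p) ∧
          ∀ θ : Fin K → ℝ, Function.Injective θ → fixErrSORT K T p ks out θ ≤ δ) := by
  classical
  refine ⟨24, by norm_num, fun K hK p δ hp0 hp hδ0 hδ => ?_⟩
  have hp1 : p ≤ 1 := by linarith
  have hH := one_sub_binEnt_pos hp
  have hK2 : (2 : ℝ) ≤ K := by exact_mod_cast hK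
  have : Nonempty (Fin K) := ⟨⟨0, by omega⟩⟩
  obtain ⟨T, ks, D, hT, hD⟩ := exists_bits_decoder hp0 hp hδ0 hδ (Fin K × Fin K)
  have hTpairs : (T : ℝ) ≤ 24 * (K : ℝ) ^ 2 * Real.log ((K : ℝ) / δ) / (1 - binEnt p) := by
    rw [Fintype.card_prod, Fintype.card_fin] at hT
    push_cast at hT
    have hlog : Real.log (2 * (K * K) / δ) ≤ 3 * Real.log (K / δ) := by
      rw [← Real.log_rpow (by positivity)]
      refine Real.log_le_log (by positivity) ?_
      norm_cast
      rw [div_pow, div_le_div_iff₀ hδ0 (by positivity)]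
      push_cast
      have : δ ^ 3 ≤ δ := pow_le_of_le_one hδ0.le (by linarith) (by norm_num)
      calc 2 * ((K : ℝ) * K) * δ ^ 3 ≤ K * (K * K) * δ := by gcongr
        _ = K ^ 3 * δ := by ring
    calc (T : ℝ) ≤ _ := hT
      _ ≤ K * K * (8 * (3 * Real.log (K / δ)) / (1 - binEnt p)) := by gcongr
      _ = _ := by ring
  refine ⟨?_, ?_, fun Xs hXs => ?_, ?_⟩
  · obtain ⟨T, ks, D, hT, hD⟩ := exists_bits_decoder hp0 hp hδ0 hδ (Fin K)
    refine ⟨T, ks, fun ys => orFun (D ys), ?_, fun θ => ?_⟩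
    · rw [Fintype.card_fin] at hT
      have hpos : 0 ≤ Real.log (K / δ) :=
        Real.log_nonneg (by rw [le_div_iff₀ hδ0]; linarith)
      have hlog : Real.log (2 * K / δ) ≤ 3 * Real.log (K / δ) := by
        rw [mul_div_assoc, Real.log_mul (by norm_num) (by positivity)]
        have : Real.log 2 ≤ Real.log (K / δ) :=
          Real.log_le_log (by norm_num) (by rw [le_div_iff₀ hδ0]; linarith)
        linarith
      calc (T : ℝ) ≤ _ := hT
        _ ≤ K * (8 * (3 * Real.log (K / δ)) / (1 - binEnt p)) := by gcongr
        _ = _ := by ring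
    · exact (sum_mul_ite_le_of_imp hp0.le hp1 (fun t => θ (ks t)) (fun ys => D ys = θ) _
        fun ys hys => congrArg orFun hys).trans (hD θ)
  · have hmax : ∀ b : Fin K × Fin K → Bool, ∃ i : Fin K, ∀ θ : Fin K → ℝ, Function.Injective θ →
        b = (fun q => decide (θ q.1 > θ q.2)) → ∀ j, j ≠ i → θ j < θ i := by
      intro b
      by_cases h : ∃ i, ∀ j, j ≠ i → b (i, j) = true
      · obtain ⟨i, hi⟩ := h
        refine ⟨i, fun θ _ hb j hj => ?_⟩
        have := hi j hj
        rw [hb] at this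
        exact of_decide_eq_true this
      · refine ⟨Classical.arbitrary _, fun θ hθ hb => absurd ?_ h⟩
        obtain ⟨i, hi⟩ := Finite.exists_max θ
        refine ⟨i, fun j hj => ?_⟩
        rw [hb]
        exact decide_eq_true ((hi j).lt_of_ne (hθ.ne hj))
    choose f hf using hmax
    refine ⟨T, ks, fun ys => f (D ys), hTpairs, fun θ hθ => ?_⟩
    let b : Fin K × Fin K → Bool := fun q => decide (θ q.1 > θ q.2)
    exact (sum_mul_ite_le_of_imp hp0.le hp1 (fun t => b (ks t)) (fun ys => D ys = b)
      (fun ys => ∀ j, j ≠ f (D ys) → θ j < θ (f (D ys)))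
      fun ys hys => hf _ θ hθ hys).trans (hD b)
  · obtain ⟨T, ks, D, hT, hD⟩ := exists_threshold_decoder hp0 hp hδ0 hδ K
    refine ⟨T, ks, D, ?_, fun x _ => ?_⟩
    · have hlog : Real.log (4 / δ) ≤ 3 * Real.log (1 / δ) := by
        rw [← Real.log_rpow (by positivity)]
        refine Real.log_le_log (by positivity) ?_
        norm_cast
        rw [div_pow, div_le_div_iff₀ hδ0 (by positivity)]
        nlinarith [mul_pos hδ0 hδ0]
      calc (T : ℝ) ≤ _ := hT
        _ ≤ K * (8 * (3 * Real.log (1 / δ)) / (1 - binEnt p)) := by gcongr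
        _ = _ := by ring
    · refine le_trans (le_of_eq ?_) (hD _ (searchIdx_le Xs x))
      simp_rw [lt_searchIdx_iff hXs]
      rfl
  · have hsort : ∀ b : Fin K × Fin K → Bool, ∃ σ : Equiv.Perm (Fin K), ∀ θ : Fin K → ℝ,
        Function.Injective θ → b = (fun q => decide (θ q.1 > θ q.2)) →
        StrictMono fun i => θ (σ i) := by
      intro b
      by_cases h : ∃ σ : Equiv.Perm (Fin K), ∀ i j, i < j → b (σ j, σ i) = true
      · obtain ⟨σ, hσ⟩ := h
        refine ⟨σ, fun θ _ hb i j hij => ?_⟩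
        have := hσ i j hij
        rw [hb] at this
        exact of_decide_eq_true this
      · refine ⟨1, fun θ hθ hb => absurd ⟨Tuple.sort θ, fun i j hij => ?_⟩ h⟩
        rw [hb]
        exact decide_eq_true ((Tuple.monotone_sort θ).strictMono_of_injective
          (hθ.comp (Tuple.sort θ).injective) hij)
    choose f hf using hsort
    refine ⟨T, ks, fun ys => f (D ys), hTpairs, fun θ hθ => ?_⟩
    let b : Fin K × Fin K → Bool := fun q => decide (θ q.1 > θ q.2)
    exact (sum_mul_ite_le_of_imp hp0.le hp1 (fun t => b (ks t)) (fun ys => D ys = b)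
      (fun ys => StrictMono fun i => θ (f (D ys) i))
      fun ys hys => hf _ θ hθ hys).trans (hD b)
end
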